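/- arXiv:2210.09137 — 7 statements merged into one kernel-verified Lean document; each statement's English description precedes it below -/
import Mathlib

section
/- Let n ≥ 1 and let K ⊆ ℝⁿ be a convex body with |K| = 1. Then the volume of the Ball body K_{n+2}(g_K) associated to the covariogram g_K of K satisfies |K_{n+2}(g_K)| ≤ binom(2n,n) / binom(2n+2,n)^{n/(n+2)}, where binom denotes the usual binomial coefficient. -/
open MeasureTheory Real Set
open scoped RealInnerProductSpace Pointwise

/-- The covariogram function of a set `K ⊆ ℝⁿ`: `g_K(x) = |K ∩ (x + K)|`. -/
noncomputable def covariogram {n : ℕ} (K : Set (EuclideanSpace ℝ (Fin n)))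
    (x : EuclideanSpace ℝ (Fin n)) : ℝ :=
  (volume (K ∩ {y | y - x ∈ K})).toReal

/-- Ball's body `K_p(g) = {x : ∫₀^∞ p t^(p-1) g(tx) dt ≥ g(0)}`. -/
noncomputable def ballBody {n : ℕ} (p : ℝ) (g : EuclideanSpace ℝ (Fin n) → ℝ) :
    Set (EuclideanSpace ℝ (Fin n)) :=
  {x | g 0 ≤ ∫ t in Ioi (0:ℝ), p * t ^ (p - 1) * g (t • x)}

/-- Generalized binomial coefficient `(x choose y) = Γ(1+x)/(Γ(1+y)Γ(1+x-y))`. -/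
noncomputable def gbinom (x y : ℝ) : ℝ :=
  Real.Gamma (1 + x) / (Real.Gamma (1 + y) * Real.Gamma (1 + x - y))


lemma bm1_compact (A B C : Set ℝ) (hA : IsCompact A) (hB : IsCompact B) (hA0 : A.Nonempty)
    (hB0 : B.Nonempty) (h : ∀ a ∈ A, ∀ b ∈ B, a + b ∈ C) :
    volume A + volume B ≤ volume C := by
  obtain ⟨a, haA, ha⟩ := hA.exists_isGreatest hA0
  obtain ⟨b, hbB, hb⟩ := hB.exists_isLeast hB0
  have h1 : volume ((fun x => x + b) '' A) = volume A := by
    simp [Set.image_add_right, measure_preimage_add_right]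
  have h2 : volume ((fun x => a + x) '' B) = volume B := by
    simp [Set.image_add_left, measure_preimage_add]
  have hm : MeasurableSet ((fun x => a + x) '' B) :=
    (hB.image (by fun_prop)).measurableSet
  have hintg : volume (((fun x => x + b) '' A) ∩ ((fun x => a + x) '' B)) = 0 := by
    refine measure_mono_null (t := {a + b}) ?_ (by simp)
    rintro _ ⟨⟨x, hx, rfl⟩, ⟨y, hy, hxy⟩⟩
    have := ha hx
    have := hb hy
    simp only [mem_singleton_iff] at *
    linarith
  rw [← h1, ← h2, ← measure_union_add_inter _ hm, hintg, add_zero]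
  refine measure_mono ?_
  rintro _ (⟨x, hx, rfl⟩ | ⟨y, hy, rfl⟩)
  · exact h _ hx _ hbB
  · exact h _ haA _ hy

lemma bm1 (A B C : Set ℝ) (hA : MeasurableSet A) (hB : MeasurableSet B) (hA0 : A.Nonempty)
    (hB0 : B.Nonempty) (h : ∀ a ∈ A, ∀ b ∈ B, a + b ∈ C) :
    volume A + volume B ≤ volume C := by
  obtain ⟨a, ha⟩ := hA0
  obtain ⟨b, hb⟩ := hB0
  rw [hA.measure_eq_iSup_isCompact, hB.measure_eq_iSup_isCompact]
  simp only [iSup_and']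
  refine ENNReal.biSup_add_biSup_le' ⟨∅, by simp⟩ ⟨∅, by simp⟩ ?_
  rintro A' ⟨hA', hcA⟩ B' ⟨hB', hcB⟩
  calc volume A' + volume B' ≤ volume (insert a A') + volume (insert b B') := by
        gcongr <;> exact subset_insert _ _
    _ ≤ volume C := by
        refine bm1_compact _ _ _ (hcA.insert a) (hcB.insert b) ⟨a, by simp⟩ ⟨b, by simp⟩ ?_
        intro x hx y hy
        exact h _ (insert_subset ha hA' hx) _ (insert_subset hb hB' hy)

lemma bm1' (A B C : Set ℝ) (hA : MeasurableSet A) (hB : MeasurableSet B) (hA0 : A.Nonempty)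
    (hB0 : B.Nonempty) (l : ℝ) (hl0 : 0 < l) (hl1 : l < 1)
    (h : ∀ a ∈ A, ∀ b ∈ B, (1 - l) * a + l * b ∈ C) :
    ENNReal.ofReal (1 - l) * volume A + ENNReal.ofReal l * volume B ≤ volume C := by
  have h1 : volume ((1 - l) • A) = ENNReal.ofReal (1 - l) * volume A := by
    rw [Measure.addHaar_smul]; simp [abs_of_pos (sub_pos.2 hl1)]
  have h2 : volume (l • B) = ENNReal.ofReal l * volume B := by
    rw [Measure.addHaar_smul]; simp [abs_of_pos hl0]
  rw [← h1, ← h2]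
  refine bm1 _ _ _ (hA.const_smul₀ _) (hB.const_smul₀ _) hA0.smul_set hB0.smul_set ?_
  rintro _ ⟨x, hx, rfl⟩ _ ⟨y, hy, rfl⟩
  simpa using h x hx y hy

lemma lc (f : ℝ → ENNReal) (hf : Measurable f) :
    ∫⁻ x, f x = ∫⁻ t in Ioi (0:ℝ), volume {x | ENNReal.ofReal t < f x} := by
  have key : ∀ c : ENNReal, ∫⁻ t in Ioi (0:ℝ), (if ENNReal.ofReal t < c then 1 else 0) = c := by
    intro c
    have : ∫⁻ t in Ioi (0:ℝ), (if ENNReal.ofReal t < c then (1:ENNReal) else 0)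
      = volume.restrict (Ioi 0) {t | ENNReal.ofReal t < c} := by
      rw [← lintegral_indicator_one (measurableSet_lt (by fun_prop) (by fun_prop))]
      refine lintegral_congr fun t => ?_
      simp [Set.indicator_apply]
    rw [this, Measure.restrict_apply (measurableSet_lt (by fun_prop) (by fun_prop))]
    by_cases hc : c = ⊤
    · subst hc; simp
    · have : {t | ENNReal.ofReal t < c} ∩ Ioi 0 = Ioo 0 c.toReal := by
        ext t
        simp only [mem_inter_iff, mem_ofPred_eq, mem_Ioi, mem_Ioo]
        constructor
        · rintro ⟨h1, h2⟩
          exact ⟨h2, (ENNReal.ofReal_lt_iff_lt_toReal h2.le hc).1 h1⟩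
        · rintro ⟨h2, h1⟩
          exact ⟨(ENNReal.ofReal_lt_iff_lt_toReal h2.le hc).2 h1, h2⟩
      rw [this]; simp [hc]
  have hm : Measurable (Function.uncurry fun (x t : ℝ) =>
      if ENNReal.ofReal t < f x then (1:ENNReal) else 0) := by
    refine Measurable.ite (measurableSet_lt (by fun_prop) (by fun_prop)) (by fun_prop) (by fun_prop)
  calc ∫⁻ x, f x = ∫⁻ x, ∫⁻ t in Ioi (0:ℝ), (if ENNReal.ofReal t < f x then 1 else 0) := by
        simp [key]
    _ = ∫⁻ t in Ioi (0:ℝ), ∫⁻ x, (if ENNReal.ofReal t < f x then 1 else 0) :=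
        lintegral_lintegral_swap hm.aemeasurable
    _ = _ := by
        congr 1; ext t
        rw [← lintegral_indicator_one (measurableSet_lt (by fun_prop) (by fun_prop))]
        refine lintegral_congr fun x => ?_
        simp [Set.indicator_apply]

lemma amgm (a b : ENNReal) (l : ℝ) (hl0 : 0 < l) (hl1 : l < 1) :
    a ^ (1 - l) * b ^ l ≤ ENNReal.ofReal (1 - l) * a + ENNReal.ofReal l * b := by
  have h1 : 0 < 1 - l := by linarith
  by_cases ha : a = ⊤
  · subst ha
    rw [ENNReal.mul_top (by simpa using h1)]; simp
  by_cases hb : b = ⊤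
  · subst hb
    rw [ENNReal.mul_top (by simpa using hl0)]; simp
  lift a to NNReal using ha
  lift b to NNReal using hb
  have := NNReal.geom_mean_le_arith_mean2_weighted (1-l).toNNReal l.toNNReal a b (by
    rw [← Real.toNNReal_add h1.le hl0.le]; simp)
  rw [Real.coe_toNNReal _ h1.le, Real.coe_toNNReal _ hl0.le] at this
  rw [← ENNReal.coe_rpow_of_nonneg _ h1.le, ← ENNReal.coe_rpow_of_nonneg _ hl0.le]
  unfold ENNReal.ofReal
  exact_mod_cast this

lemma cov_lt_geom (t a b : ENNReal) (l : ℝ) (hl0 : 0 < l) (hl1 : l < 1) (ha : t < a) (hb : t < b) :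
    t < a ^ (1 - l) * b ^ l := by
  have h1 : 0 < 1 - l := by linarith
  calc t = t ^ (1 - l) * t ^ l := by
        rw [← ENNReal.rpow_add_of_nonneg _ _ h1.le hl0.le]; simp
    _ < a ^ (1 - l) * b ^ l := by
        exact ENNReal.mul_lt_mul (ENNReal.rpow_lt_rpow ha h1) (ENNReal.rpow_lt_rpow hb hl0)

lemma pl1_norm (f g h : ℝ → ENNReal) (hf : Measurable f) (hg : Measurable g) (hh : Measurable h)
    (l : ℝ) (hl0 : 0 < l) (hl1 : l < 1) (hf1 : ⨆ x, f x = 1) (hg1 : ⨆ x, g x = 1)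
    (H : ∀ x y, f x ^ (1 - l) * g y ^ l ≤ h ((1 - l) * x + l * y)) :
    (∫⁻ x, f x) ^ (1 - l) * (∫⁻ x, g x) ^ l ≤ ∫⁻ x, h x := by
  refine (amgm _ _ l hl0 hl1).trans ?_
  rw [lc f hf, lc g hg, lc h hh]
  have hmeas : ∀ f : ℝ → ENNReal, Measurable fun t : ℝ => volume {x | ENNReal.ofReal t < f x} := by
    intro f
    refine Antitone.measurable ?_
    intro s t hst
    refine measure_mono ?_
    intro x hx
    exact (ENNReal.ofReal_le_ofReal hst).trans_lt hx
  rw [← lintegral_const_mul _ (hmeas f), ← lintegral_const_mul _ (hmeas g),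
    ← lintegral_add_left ((hmeas f).const_mul _)]
  refine lintegral_mono fun t => ?_
  by_cases ht : ENNReal.ofReal t < 1
  · refine bm1' _ _ _ (measurableSet_lt (by fun_prop) (by fun_prop))
      (measurableSet_lt (by fun_prop) (by fun_prop)) ?_ ?_ l hl0 hl1 ?_
    · rw [← hf1] at ht; exact lt_iSup_iff.1 ht
    · rw [← hg1] at ht; exact lt_iSup_iff.1 ht
    · intro a ha b hb
      exact (cov_lt_geom _ _ _ l hl0 hl1 ha hb).trans_le (H a b)
  · have e1 : {x | ENNReal.ofReal t < f x} = ∅ := by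
      ext x; simp only [mem_ofPred_eq, mem_empty_iff_false, iff_false, not_lt]
      exact ((le_iSup f x).trans hf1.le).trans (not_lt.1 ht)
    have e2 : {x | ENNReal.ofReal t < g x} = ∅ := by
      ext x; simp only [mem_ofPred_eq, mem_empty_iff_false, iff_false, not_lt]
      exact ((le_iSup g x).trans hg1.le).trans (not_lt.1 ht)
    simp [e1, e2]

lemma pl1_bdd (f g h : ℝ → ENNReal) (hf : Measurable f) (hg : Measurable g) (hh : Measurable h)
    (l : ℝ) (hl0 : 0 < l) (hl1 : l < 1) (hf1 : ⨆ x, f x ≠ ⊤) (hg1 : ⨆ x, g x ≠ ⊤)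
    (H : ∀ x y, f x ^ (1 - l) * g y ^ l ≤ h ((1 - l) * x + l * y)) :
    (∫⁻ x, f x) ^ (1 - l) * (∫⁻ x, g x) ^ l ≤ ∫⁻ x, h x := by
  have h1 : 0 < 1 - l := by linarith
  set a := ⨆ x, f x with ha
  set b := ⨆ x, g x with hb
  by_cases ha0 : a = 0
  · have : ∀ x, f x = 0 := fun x => le_antisymm ((le_iSup f x).trans ha0.le) (by simp)
    simp [this, h1]
  by_cases hb0 : b = 0
  · have : ∀ x, g x = 0 := fun x => le_antisymm ((le_iSup g x).trans hb0.le) (by simp)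
    simp [this, hl0]
  set c := (a⁻¹) ^ (1 - l) * (b⁻¹) ^ l with hc
  have hc0 : c ≠ 0 := by
    simp only [hc, ne_eq, mul_eq_zero, not_or]
    constructor <;> simp [ENNReal.rpow_eq_zero_iff, hf1, hg1, ha0, hb0]
  have hct : c ≠ ⊤ := by
    refine ENNReal.mul_ne_top ?_ ?_
    · exact ENNReal.rpow_ne_top_of_nonneg h1.le (by simp [ha0])
    · exact ENNReal.rpow_ne_top_of_nonneg hl0.le (by simp [hb0])
  have := pl1_norm (fun x => a⁻¹ * f x) (fun x => b⁻¹ * g x) (fun x => c * h x)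
    (hf.const_mul _) (hg.const_mul _) (hh.const_mul _) l hl0 hl1
    (by rw [← ENNReal.mul_iSup, ← ha, ENNReal.inv_mul_cancel ha0 hf1])
    (by rw [← ENNReal.mul_iSup, ← hb, ENNReal.inv_mul_cancel hb0 hg1]) (by
      intro x y
      rw [ENNReal.mul_rpow_of_nonneg _ _ h1.le, ENNReal.mul_rpow_of_nonneg _ _ hl0.le,
        mul_mul_mul_comm]
      exact mul_le_mul_right (H x y) c)
  rw [lintegral_const_mul _ hf, lintegral_const_mul _ hg, lintegral_const_mul _ hh,
    ENNReal.mul_rpow_of_nonneg _ _ h1.le, ENNReal.mul_rpow_of_nonneg _ _ hl0.le,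
        mul_mul_mul_comm] at this
  exact (ENNReal.mul_le_mul_iff_right hc0 hct).1 this

lemma trunc_tendsto (f : ℝ → ENNReal) (hf : Measurable f) :
    Filter.Tendsto (fun N : ℕ => ∫⁻ x, min (f x) N) Filter.atTop (nhds (∫⁻ x, f x)) := by
  refine lintegral_tendsto_of_tendsto_of_monotone (fun N => (hf.min measurable_const).aemeasurable)
    ?_ ?_
  · refine Filter.Eventually.of_forall fun x => ?_
    intro i j hij
    exact min_le_min le_rfl (by exact_mod_cast hij)
  · refine Filter.Eventually.of_forall fun x => ?_
    have := (tendsto_const_nhds (x := f x) (f := Filter.atTop)).min ENNReal.tendsto_nat_nhds_top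
    simpa using this

lemma pl1 (f g h : ℝ → ENNReal) (hf : Measurable f) (hg : Measurable g) (hh : Measurable h)
    (l : ℝ) (hl0 : 0 < l) (hl1 : l < 1)
    (H : ∀ x y, f x ^ (1 - l) * g y ^ l ≤ h ((1 - l) * x + l * y)) :
    (∫⁻ x, f x) ^ (1 - l) * (∫⁻ x, g x) ^ l ≤ ∫⁻ x, h x := by
  have h1 : 0 < 1 - l := by linarith
  by_cases ha0 : ∫⁻ x, f x = 0
  · simp [ha0, h1]
  by_cases hb0 : ∫⁻ x, g x = 0
  · simp [hb0, hl0]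
  refine le_of_tendsto (ENNReal.Tendsto.mul
    ((ENNReal.continuous_rpow_const (y := 1 - l)).continuousAt.tendsto.comp (trunc_tendsto f hf)) 
    (Or.inl ?_)
    ((ENNReal.continuous_rpow_const (y := l)).continuousAt.tendsto.comp (trunc_tendsto g hg)) 
    (Or.inl ?_)) (Filter.Eventually.of_forall fun N => ?_)
  · simp [ENNReal.rpow_eq_zero_iff, ha0]; intro; linarith
  · simp [ENNReal.rpow_eq_zero_iff, hb0]; intro; linarith
  · refine pl1_bdd _ _ _ (hf.min measurable_const) (hg.min measurable_const) hh l hl0 hl1 ?_ ?_ ?_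
    · exact ne_top_of_le_ne_top (ENNReal.natCast_ne_top N) (iSup_le fun x => min_le_right _ _)
    · exact ne_top_of_le_ne_top (ENNReal.natCast_ne_top N) (iSup_le fun x => min_le_right _ _)
    · intro x y
      refine le_trans ?_ (H x y)
      gcongr <;> exact min_le_left _ _

lemma pln (n : ℕ) : ∀ (f g h : (Fin n → ℝ) → ENNReal), Measurable f → Measurable g → Measurable h →
    ∀ (l : ℝ), 0 < l → l < 1 →
    (∀ x y, f x ^ (1 - l) * g y ^ l ≤ h ((1 - l) • x + l • y)) →
    (∫⁻ x, f x) ^ (1 - l) * (∫⁻ x, g x) ^ l ≤ ∫⁻ x, h x := by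
  induction n with
  | zero =>
    intro f g h hf hg hh l hl0 hl1 H
    have hd : (volume : Measure (Fin 0 → ℝ)) = Measure.dirac 0 := by
      rw [volume_pi]; exact Measure.pi_of_empty _ _
    rw [hd, lintegral_dirac, lintegral_dirac, lintegral_dirac]
    simpa using H 0 0
  | succ n ih =>
    intro f g h hf hg hh l hl0 hl1 H
    have e := (volume_preserving_piFinSuccAbove (fun _ : Fin (n+1) => ℝ) 0).symm
    have he : ∀ p : ℝ × (Fin n → ℝ), (MeasurableEquiv.piFinSuccAbove (fun _ : Fin (n+1) => ℝ) 0).symm p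
        = (Fin.cons p.1 p.2 : Fin (n+1) → ℝ) := by
      intro p
      simp [MeasurableEquiv.piFinSuccAbove_symm_apply, Fin.insertNthEquiv]
    have key : ∀ f : (Fin (n+1) → ℝ) → ENNReal, Measurable f →
      ∫⁻ x, f x = ∫⁻ s : ℝ, ∫⁻ y : Fin n → ℝ, f (Fin.cons s y) := by
      intro f hf
      rw [← e.lintegral_comp hf, Measure.volume_eq_prod, lintegral_prod]
      · simp only [he]
      · exact (hf.comp (MeasurableEquiv.measurable _)).aemeasurable
    have hcons : Measurable fun p : ℝ × (Fin n → ℝ) => (Fin.cons p.1 p.2 : Fin (n+1) → ℝ) := by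
      simp only [← he]
      exact (MeasurableEquiv.piFinSuccAbove (fun _ : Fin (n+1) => ℝ) 0).symm.measurable
    rw [key f hf, key g hg, key h hh]
    refine pl1 _ _ _ (hf.comp hcons).lintegral_prod_right' (hg.comp hcons).lintegral_prod_right'
      (hh.comp hcons).lintegral_prod_right' l hl0 hl1 ?_
    intro s t
    refine ih _ _ _ (hf.comp (hcons.comp measurable_prodMk_left))
      (hg.comp (hcons.comp measurable_prodMk_left))
      (hh.comp (hcons.comp measurable_prodMk_left)) l hl0 hl1 ?_
    intro x y
    refine (H (Fin.cons s x) (Fin.cons t y)).trans (le_of_eq ?_)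
    simp only [Function.comp]
    congr 1
    ext i
    refine Fin.cases ?_ (fun j => ?_) i <;> simp

lemma cov_beta (a : ℝ) (k : ℕ) : ∀ m : ℕ, ∫ t in (0:ℝ)..a, t ^ m * (a - t) ^ k =
    a ^ (m + k + 1) * (m.factorial * k.factorial / (m + k + 1).factorial) := by
  induction k with
  | zero =>
    intro m
    simp [integral_pow, Nat.factorial_succ]
    field_simp
  | succ k ih =>
    intro m
    have h : ∀ t : ℝ, t ^ m * (a - t) ^ (k + 1) = a * (t ^ m * (a - t) ^ k)
        - t ^ (m + 1) * (a - t) ^ k := by intro t; ring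
    simp only [h]
    rw [intervalIntegral.integral_sub (Continuous.intervalIntegrable (by fun_prop) _ _)
      (Continuous.intervalIntegrable (by fun_prop) _ _), intervalIntegral.integral_const_mul, ih, ih]
    have e1 : m + 1 + k + 1 = (m + k + 1) + 1 := by ring
    have e2 : m + (k + 1) + 1 = (m + k + 1) + 1 := by ring
    rw [e1, e2]
    simp only [Nat.factorial_succ]
    have : ((m + k).factorial : ℝ) ≠ 0 := by positivity
    push_cast
    field_simp
    ring

lemma cov_L_integral (a : ℝ) (ha : 0 < a) (n m : ℕ) (hn : 1 ≤ n) :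
    IntegrableOn (fun t => t ^ m * (max 0 (1 - t / a)) ^ n) (Ioi (0:ℝ)) ∧
    ∫ t in Ioi (0:ℝ), t ^ m * (max 0 (1 - t / a)) ^ n =
    a ^ (m + 1) * (m.factorial * n.factorial / (m + n + 1).factorial) := by
  have hz : ∀ t ∈ Ioi (0:ℝ) \ Ioc 0 a, t ^ m * (max 0 (1 - t / a)) ^ n = 0 := by
    intro t ht
    have h1 : 0 < t := ht.1
    have h2 : a < t := by
      by_contra h; exact ht.2 ⟨h1, not_lt.1 h⟩
    have : 1 - t / a ≤ 0 := by
      have := (one_lt_div ha).2 h2; linarith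
    rw [max_eq_left this, zero_pow (by omega), mul_zero]
  have hI : IntegrableOn (fun t : ℝ => t ^ m * (max 0 (1 - t / a)) ^ n) (Ioc 0 a) :=
    (Continuous.intervalIntegrable (by fun_prop) 0 a).1
  refine ⟨hI.of_forall_sdiff_eq_zero measurableSet_Ioi hz, ?_⟩
  rw [setIntegral_eq_of_subset_of_forall_sdiff_eq_zero measurableSet_Ioi
    (fun t ht => ht.1) hz, ← intervalIntegral.integral_of_le ha.le]
  have : ∫ t in (0:ℝ)..a, t ^ m * (max 0 (1 - t / a)) ^ n
      = ∫ t in (0:ℝ)..a, (1 / a ^ n) * (t ^ m * (a - t) ^ n) := by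
    refine intervalIntegral.integral_congr fun t ht => ?_
    rw [uIcc_of_le ha.le] at ht
    have : 0 ≤ 1 - t / a := by
      have := (div_le_one ha).2 ht.2; linarith
    rw [max_eq_right this]
    have : 1 - t / a = (a - t) / a := by field_simp
    rw [this, div_pow]; ring
  rw [this, intervalIntegral.integral_const_mul, cov_beta, show m + n + 1 = n + (m + 1) by ring, pow_add]
  field_simp

lemma cov_f_integrable (f : ℝ → ℝ) (hfm : Measurable f) (hf0 : ∀ t, 0 ≤ f t)
    (hf1 : ∀ t, f t ≤ 1) (R : ℝ) (hR : ∀ t, R < t → f t = 0) (m : ℕ) :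
    IntegrableOn (fun t => t ^ m * f t) (Ioi (0:ℝ)) := by
  have hz : ∀ t ∈ Ioi (0:ℝ) \ Ioc 0 R, t ^ m * f t = 0 := by
    intro t ht
    have h2 : R < t := by
      by_contra h; exact ht.2 ⟨ht.1, not_lt.1 h⟩
    rw [hR t h2, mul_zero]
  refine IntegrableOn.of_forall_sdiff_eq_zero (s := Ioc 0 R) ?_ measurableSet_Ioi hz
  refine Integrable.mono' (g := fun _ => |R| ^ m) (by simp) (by fun_prop) ?_
  filter_upwards [ae_restrict_mem measurableSet_Ioc] with t ht
  rw [norm_mul, norm_pow, Real.norm_of_nonneg ht.1.le, Real.norm_of_nonneg (hf0 t)]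
  calc t ^ m * f t ≤ t ^ m * 1 := by
        have := pow_nonneg ht.1.le m
        gcongr; exact hf1 t
    _ ≤ |R| ^ m := by
        rw [mul_one]
        exact pow_le_pow_left₀ ht.1.le (ht.2.trans (le_abs_self R)) m

lemma cov_berwald (n : ℕ) (hn : 1 ≤ n) (f : ℝ → ℝ) (hfm : Measurable f) (hf0 : ∀ t, 0 ≤ f t)
    (hf1 : ∀ t, f t ≤ 1) (R : ℝ) (hR : ∀ t, R < t → f t = 0)
    (hc : ∀ s t, 0 < s → s < t → ∀ β, 0 < β → f t = β ^ n →
      ((1 - s / t) + (s / t) * β) ^ n ≤ f s) (a : ℝ) (ha : 0 < a)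
    (hφ : ∫ t in Ioi (0:ℝ), t ^ (n + 1) * (max 0 (1 - t / a)) ^ n ≤
      ∫ t in Ioi (0:ℝ), t ^ (n + 1) * f t) :
    ∫ t in Ioi (0:ℝ), t ^ (n - 1) * (max 0 (1 - t / a)) ^ n ≤
      ∫ t in Ioi (0:ℝ), t ^ (n - 1) * f t := by
  set L : ℝ → ℝ := fun t => (max 0 (1 - t / a)) ^ n with hL
  have hn0 : n ≠ 0 := by omega
  set U : Set ℝ := {t | 0 < t ∧ L t ≤ f t ∧ 0 < f t} with hU
  have hdown : ∀ s t, 0 < s → s < t → t ∈ U → s ∈ U := by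
    rintro s t hs hst ⟨ht, h1, h2⟩
    set β := (f t) ^ ((n:ℝ)⁻¹) with hβ
    have hβ0 : 0 < β := Real.rpow_pos_of_pos h2 _
    have hβn : f t = β ^ n := (Real.rpow_inv_natCast_pow h2.le hn0).symm
    have hk := hc s t hs hst β hβ0 hβn
    have hLβ : max 0 (1 - t / a) ≤ β := by
      rw [hβn] at h1
      exact le_of_pow_le_pow_left₀ hn0 hβ0.le h1
    have hst1 : s / t < 1 := (div_lt_one ht).2 hst
    have hst0 : 0 < s / t := div_pos hs ht
    have hpos : 0 < (1 - s / t) + (s / t) * β := by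
      have := mul_pos hst0 hβ0; linarith
    refine ⟨hs, le_trans ?_ hk, lt_of_lt_of_le (pow_pos hpos n) hk⟩
    refine pow_le_pow_left₀ (le_max_left _ _) (max_le hpos.le ?_) n
    have : 1 - t / a ≤ β := (le_max_right _ _).trans hLβ
    have h3 := mul_le_mul_of_nonneg_left this hst0.le
    have h4 : s / t * (1 - t / a) = s / t - s / a := by field_simp
    linarith
  have hout : ∀ t, 0 < t → t ∉ U → f t ≤ L t := by
    intro t ht htU
    by_contra h
    push Not at h
    have hL0 : 0 ≤ L t := pow_nonneg (le_max_left _ _) n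
    exact htU ⟨ht, h.le, lt_of_le_of_lt hL0 h⟩
  have hbdd : BddAbove U := by
    refine ⟨R, ?_⟩
    rintro t ⟨_, _, h⟩
    by_contra h'
    rw [hR t (not_le.1 h')] at h
    exact lt_irrefl _ h
  obtain ⟨hLi1, -⟩ := cov_L_integral a ha n (n+1) hn
  obtain ⟨hLi2, -⟩ := cov_L_integral a ha n (n-1) hn
  have hfi1 := cov_f_integrable f hfm hf0 hf1 R hR (n+1)
  have hfi2 := cov_f_integrable f hfm hf0 hf1 R hR (n-1)
  change IntegrableOn (fun t => t ^ (n + 1) * L t) (Ioi 0) at hLi1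
  change IntegrableOn (fun t => t ^ (n - 1) * L t) (Ioi 0) at hLi2
  have hd1 : IntegrableOn (fun t => t ^ (n + 1) * L t - t ^ (n + 1) * f t) (Ioi 0) := hLi1.sub hfi1
  have hd2 : IntegrableOn (fun t => t ^ (n + 1) * f t - t ^ (n + 1) * L t) (Ioi 0) := hfi1.sub hLi1
  have hd3 : IntegrableOn (fun t => t ^ (n - 1) * f t - t ^ (n - 1) * L t) (Ioi 0) := hfi2.sub hLi2
  rcases U.eq_empty_or_nonempty with hUe | ⟨u, hu⟩
  · have hle : ∀ t, 0 < t → f t ≤ L t := fun t ht => hout t ht (by simp [hUe])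
    have hz : ∫ t in Ioi (0:ℝ), (t ^ (n + 1) * L t - t ^ (n + 1) * f t) = 0 := by
      refine le_antisymm ?_ ?_
      · rw [integral_sub hLi1 hfi1]; linarith
      · refine setIntegral_nonneg measurableSet_Ioi fun t ht => ?_
        have := mul_le_mul_of_nonneg_left (hle t ht) (pow_nonneg (le_of_lt ht) (n+1))
        linarith
    rw [setIntegral_eq_zero_iff_of_nonneg_ae ?_ hd1] at hz
    · refine le_of_eq (integral_congr_ae ?_)
      filter_upwards [hz, ae_restrict_mem measurableSet_Ioi] with t ht ht0
      have ht0' : 0 < t := ht0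
      have : t ^ (n+1) * (L t - f t) = 0 := by
        simp only [Pi.zero_apply] at ht; linarith
      have h2 : L t = f t := by
        rcases mul_eq_zero.1 this with h | h
        · exact absurd h (pow_pos ht0' _).ne'
        · linarith
      have h3 : (max 0 (1 - t / a)) ^ n = L t := rfl
      simp only [h3, h2]
    · filter_upwards [ae_restrict_mem measurableSet_Ioi] with t ht
      have := mul_le_mul_of_nonneg_left (hle t ht) (pow_nonneg (le_of_lt ht) (n+1))
      simp only [Pi.zero_apply]
      linarith
  · set T := sSup U with hT
    have hT0 : 0 < T := lt_of_lt_of_le hu.1 (le_csSup hbdd hu)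
    have hpt : ∀ t, 0 < t → 0 ≤ T ^ 2 * (t ^ (n-1) * f t - t ^ (n-1) * L t)
        - (t ^ (n+1) * f t - t ^ (n+1) * L t) := by
      intro t ht
      have e : T ^ 2 * (t ^ (n-1) * f t - t ^ (n-1) * L t)
        - (t ^ (n+1) * f t - t ^ (n+1) * L t) = t ^ (n-1) * ((T ^ 2 - t ^ 2) * (f t - L t)) := by
        obtain ⟨k, rfl⟩ : ∃ k, n = k + 1 := ⟨n - 1, by omega⟩
        simp only [Nat.add_sub_cancel]
        ring
      rw [e]
      refine mul_nonneg (pow_nonneg ht.le _) ?_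
      by_cases htU : t ∈ U
      · have h1 : t ≤ T := le_csSup hbdd htU
        refine mul_nonneg ?_ (sub_nonneg.2 htU.2.1)
        have := pow_le_pow_left₀ ht.le h1 2
        linarith
      · have h1 : T ≤ t := by
          refine csSup_le ⟨u, hu⟩ fun v hv => ?_
          by_contra h
          exact htU (hdown t v ht (not_le.1 h) hv)
        refine mul_nonneg_of_nonpos_of_nonpos ?_ (sub_nonpos.2 (hout t ht htU))
        have := pow_le_pow_left₀ hT0.le h1 2
        linarith
    have hintg : 0 ≤ ∫ t in Ioi (0:ℝ), (T ^ 2 * (t ^ (n-1) * f t - t ^ (n-1) * L t)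
        - (t ^ (n+1) * f t - t ^ (n+1) * L t)) :=
      setIntegral_nonneg measurableSet_Ioi hpt
    rw [integral_sub (hd3.const_mul _) hd2, integral_const_mul,
      integral_sub hfi2 hLi2, integral_sub hfi1 hLi1] at hintg
    have h2 : 0 ≤ T ^ 2 * ((∫ t in Ioi (0:ℝ), t ^ (n - 1) * f t) -
      ∫ t in Ioi (0:ℝ), t ^ (n - 1) * L t) := by linarith
    have := nonneg_of_mul_nonneg_right h2 (pow_pos hT0 2)
    linarith

lemma cov_berwald' (n : ℕ) (hn : 1 ≤ n) (f : ℝ → ℝ) (hfm : Measurable f) (hf0 : ∀ t, 0 ≤ f t)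
    (hf1 : ∀ t, f t ≤ 1) (R : ℝ) (hR : ∀ t, R < t → f t = 0)
    (hc : ∀ s t, 0 < s → s < t → ∀ β, 0 < β → f t = β ^ n →
      ((1 - s / t) + (s / t) * β) ^ n ≤ f s)
    (hφ : 1 ≤ ∫ t in Ioi (0:ℝ), ((n:ℝ) + 2) * t ^ (((n:ℝ) + 2) - 1) * f t) :
    (Nat.choose (2 * n + 2) n : ℝ) ^ ((n : ℝ) / ((n : ℝ) + 2)) / (Nat.choose (2 * n) n : ℝ) ≤
      ∫ t in Ioi (0:ℝ), n * (t ^ (n - 1) * f t) := by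
  have hC : (0:ℝ) < (Nat.choose (2 * n + 2) n : ℝ) := by
    exact_mod_cast Nat.choose_pos (by omega)
  have hn2 : (0:ℝ) < (n:ℝ) + 2 := by positivity
  set a : ℝ := (Nat.choose (2 * n + 2) n : ℝ) ^ ((1:ℝ) / ((n : ℝ) + 2)) with ha
  have ha0 : 0 < a := Real.rpow_pos_of_pos hC _
  have han2 : a ^ (n + 2) = (Nat.choose (2 * n + 2) n : ℝ) := by
    rw [ha, ← Real.rpow_natCast, ← Real.rpow_mul hC.le]
    push_cast
    rw [one_div, inv_mul_cancel₀ hn2.ne', Real.rpow_one]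
  have han : a ^ n = (Nat.choose (2 * n + 2) n : ℝ) ^ ((n : ℝ) / ((n : ℝ) + 2)) := by
    rw [ha, ← Real.rpow_natCast, ← Real.rpow_mul hC.le]
    congr 1; ring
  have h1 : ∫ t in Ioi (0:ℝ), ((n:ℝ) + 2) * t ^ (((n:ℝ) + 2) - 1) * f t =
      ((n:ℝ) + 2) * ∫ t in Ioi (0:ℝ), t ^ (n + 1) * f t := by
    rw [← integral_const_mul]
    refine setIntegral_congr_fun measurableSet_Ioi fun t ht => ?_
    have : t ^ (((n:ℝ) + 2) - 1) = t ^ (n + 1) := by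
      rw [← Real.rpow_natCast]; congr 1; push_cast; ring
    simp only [this]; ring
  rw [h1] at hφ
  have hb := cov_berwald n hn f hfm hf0 hf1 R hR hc a ha0 ?_
  · rw [(cov_L_integral a ha0 n (n-1) hn).2] at hb
    rw [integral_const_mul]
    refine le_trans (le_of_eq ?_) (mul_le_mul_of_nonneg_left hb (Nat.cast_nonneg n))
    rw [← han, Nat.cast_choose ℝ (show n ≤ 2 * n by omega)]
    obtain ⟨k, rfl⟩ : ∃ k, n = k + 1 := ⟨n - 1, by omega⟩
    rw [show 2 * (k+1) - (k+1) = k + 1 by omega, show k + 1 - 1 = k by omega,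
      show k + (k + 1) + 1 = 2 * (k+1) by ring]
    have e3 : ((k+1).factorial : ℝ) = (k+1) * k.factorial := by
      rw [Nat.factorial_succ]; push_cast; ring
    rw [e3]
    have : (((2 * (k+1)).factorial : ℕ) : ℝ) ≠ 0 := by positivity
    field_simp
    push_cast
    ring
  · rw [(cov_L_integral a ha0 n (n+1) hn).2]
    rw [← mul_le_mul_iff_right₀ hn2]
    refine le_trans (le_of_eq ?_) hφ
    rw [show n + 1 + 1 = n + 2 by ring, han2, Nat.cast_choose ℝ (show n ≤ 2 * n + 2 by omega),
      show 2 * n + 2 - n = n + 2 by omega, show n + 1 + n + 1 = 2 * n + 2 by ring,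
      Nat.factorial_succ (n+1)]
    have : (((2 * n + 2).factorial : ℕ) : ℝ) ≠ 0 := by positivity
    push_cast
    field_simp
    ring


lemma cov_plE {n : ℕ} (A B C : Set (EuclideanSpace ℝ (Fin n))) (hA : MeasurableSet A)
    (hB : MeasurableSet B) (hC : MeasurableSet C) (hA1 : volume A = 1) (hB1 : volume B = 1)
    (l : ℝ) (hl0 : 0 < l) (hl1 : l < 1) (h : ∀ a ∈ A, ∀ b ∈ B, (1 - l) • a + l • b ∈ C) :
    1 ≤ volume C := by
  have hmp := PiLp.volume_preserving_toLp (Fin n)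
  have key : ∀ A : Set (EuclideanSpace ℝ (Fin n)), MeasurableSet A →
      Measurable ((WithLp.toLp 2 ⁻¹' A : Set (Fin n → ℝ)).indicator (1 : (Fin n → ℝ) → ENNReal)) ∧
      ∫⁻ x, (WithLp.toLp 2 ⁻¹' A : Set (Fin n → ℝ)).indicator (1 : (Fin n → ℝ) → ENNReal) x
        = volume A := by
    intro A hA
    have hm : MeasurableSet (WithLp.toLp 2 ⁻¹' A : Set (Fin n → ℝ)) := hmp.measurable hA
    refine ⟨measurable_one.indicator hm, ?_⟩
    rw [lintegral_indicator_one hm, hmp.measure_preimage hA.nullMeasurableSet]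
  have := pln n _ _ _ (key A hA).1 (key B hB).1 (key C hC).1 l hl0 hl1 ?_
  · rw [(key A hA).2, (key B hB).2, (key C hC).2, hA1, hB1] at this
    simpa using this
  · intro x y
    have h1 : 0 < 1 - l := by linarith
    by_cases hx : WithLp.toLp 2 x ∈ A
    · by_cases hy : WithLp.toLp 2 y ∈ B
      · have : (1 - l) • x + l • y ∈ (WithLp.toLp 2 ⁻¹' C : Set (Fin n → ℝ)) := by
          simpa using h _ hx _ hy
        rw [indicator_of_mem this, indicator_of_mem (show x ∈ WithLp.toLp 2 ⁻¹' A from hx),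
          indicator_of_mem (show y ∈ WithLp.toLp 2 ⁻¹' B from hy)]
        simp
      · rw [indicator_of_notMem (show y ∉ WithLp.toLp 2 ⁻¹' B from hy)]
        simp [hl0]
    · rw [indicator_of_notMem (show x ∉ WithLp.toLp 2 ⁻¹' A from hx)]
      simp [h1]

lemma cov_bm {n : ℕ} (A B C : Set (EuclideanSpace ℝ (Fin n))) (hA : MeasurableSet A)
    (hB : MeasurableSet B) (hC : MeasurableSet C) (hA1 : volume A = 1)
    (β : ℝ) (hβ : 0 < β) (hB1 : volume B = ENNReal.ofReal (β ^ n))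
    (l : ℝ) (hl0 : 0 < l) (hl1 : l < 1) (h : ∀ a ∈ A, ∀ b ∈ B, (1 - l) • a + l • b ∈ C) :
    ENNReal.ofReal (((1 - l) + l * β) ^ n) ≤ volume C := by
  have hlβ : 0 < l * β := mul_pos hl0 hβ
  set s := (1 - l) + l * β with hs
  have hs0 : 0 < s := by linarith
  have hvol : ∀ (r : ℝ) (D : Set (EuclideanSpace ℝ (Fin n))), 0 < r →
      volume (r⁻¹ • D) = ENNReal.ofReal ((r ^ n)⁻¹) * volume D := by
    intro r D hr
    rw [Measure.addHaar_smul_of_nonneg _ (by positivity)]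
    simp
  have h1 := cov_plE A (β⁻¹ • B) (s⁻¹ • C) hA (hB.const_smul₀ _) (hC.const_smul₀ _) hA1 ?_
    (l * β / s) (by positivity) ((div_lt_one hs0).2 (by linarith)) ?_
  · rw [hvol _ _ hs0] at h1
    have hp : 0 < s ^ n := pow_pos hs0 n
    calc ENNReal.ofReal (s ^ n) = ENNReal.ofReal (s ^ n) * 1 := by simp
      _ ≤ ENNReal.ofReal (s ^ n) * (ENNReal.ofReal ((s ^ n)⁻¹) * volume C) := by gcongr
      _ = volume C := by
        rw [← mul_assoc, ← ENNReal.ofReal_mul hp.le, mul_inv_cancel₀ hp.ne']; simp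
  · have hp : 0 < β ^ n := pow_pos hβ n
    rw [hvol _ _ hβ, hB1, ← ENNReal.ofReal_mul (by positivity), inv_mul_cancel₀ hp.ne']
    simp
  · rintro a ha _ ⟨b, hb, rfl⟩
    refine ⟨_, h a ha b hb, ?_⟩
    simp only [smul_add, smul_smul]
    congr 2
    · field_simp; rw [hs]; ring
    · field_simp

lemma cov_measSet {n : ℕ} (K : Set (EuclideanSpace ℝ (Fin n))) (hK : MeasurableSet K) :
    MeasurableSet {p : EuclideanSpace ℝ (Fin n) × EuclideanSpace ℝ (Fin n) |
      p.2 ∈ K ∧ p.2 - p.1 ∈ K} :=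
  (measurable_snd hK).inter ((measurable_snd.sub measurable_fst) hK)

lemma cov_measurable_aux {n : ℕ} (K : Set (EuclideanSpace ℝ (Fin n))) (hK : MeasurableSet K) :
    Measurable fun x : EuclideanSpace ℝ (Fin n) => volume (K ∩ {y | y - x ∈ K}) :=
  measurable_measure_prodMk_left (cov_measSet K hK)

lemma cov_measurable {n : ℕ} (K : Set (EuclideanSpace ℝ (Fin n))) (hK : MeasurableSet K) :
    Measurable (covariogram K) := (cov_measurable_aux K hK).ennreal_toReal

lemma cov_lintegral {n : ℕ} (K : Set (EuclideanSpace ℝ (Fin n))) (hK : MeasurableSet K)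
    (hKvol : volume K = 1) :
    ∫⁻ x, ENNReal.ofReal (covariogram K x) = 1 := by
  have h0 : ∀ x, ENNReal.ofReal (covariogram K x) = volume (K ∩ {y | y - x ∈ K}) := by
    intro x
    refine ENNReal.ofReal_toReal (ne_top_of_le_ne_top ?_ (measure_mono inter_subset_left))
    simp [hKvol]
  simp only [h0]
  have h1 := Measure.prod_apply (μ := (volume : Measure (EuclideanSpace ℝ (Fin n))))
    (ν := (volume : Measure (EuclideanSpace ℝ (Fin n)))) (cov_measSet K hK)
  have h2 := Measure.prod_apply_symm (μ := (volume : Measure (EuclideanSpace ℝ (Fin n))))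
    (ν := (volume : Measure (EuclideanSpace ℝ (Fin n)))) (cov_measSet K hK)
  refine (h1.symm.trans h2).trans ?_
  have h3 : ∀ y : EuclideanSpace ℝ (Fin n), volume ((fun x => (x, y)) ⁻¹'
      {p : EuclideanSpace ℝ (Fin n) × EuclideanSpace ℝ (Fin n) | p.2 ∈ K ∧ p.2 - p.1 ∈ K})
      = K.indicator 1 y := by
    intro y
    by_cases hy : y ∈ K
    · rw [indicator_of_mem hy]
      have : ((fun x => (x, y)) ⁻¹'
        {p : EuclideanSpace ℝ (Fin n) × EuclideanSpace ℝ (Fin n) | p.2 ∈ K ∧ p.2 - p.1 ∈ K})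
        = (fun x => y - x) ⁻¹' K := by ext x; simp [hy]
      rw [this, (Measure.measurePreserving_sub_left volume y).measure_preimage hK.nullMeasurableSet, hKvol]
      rfl
    · rw [indicator_of_notMem hy]
      have : ((fun x => (x, y)) ⁻¹'
        {p : EuclideanSpace ℝ (Fin n) × EuclideanSpace ℝ (Fin n) | p.2 ∈ K ∧ p.2 - p.1 ∈ K})
        = ∅ := by ext x; simp [hy]
      rw [this]; simp
  simp only [h3]
  rw [lintegral_indicator_one hK, hKvol]

lemma cov_polar {n : ℕ} (hn : 1 ≤ n) (F : EuclideanSpace ℝ (Fin n) → ENNReal) (hF : Measurable F) :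
    ∫⁻ x, F x = ∫⁻ θ : Metric.sphere (0 : EuclideanSpace ℝ (Fin n)) 1,
      (∫⁻ r in Ioi (0:ℝ), ENNReal.ofReal (r ^ (n - 1)) *
      F (r • (θ : EuclideanSpace ℝ (Fin n))))
      ∂((volume : Measure (EuclideanSpace ℝ (Fin n))).toSphere) := by
  haveI : Nonempty (Fin n) := ⟨⟨0, hn⟩⟩
  set μ := (volume : Measure (EuclideanSpace ℝ (Fin n))) with hμ
  have hmp := μ.measurePreserving_homeomorphUnitSphereProd
  have hdim : Module.finrank ℝ (EuclideanSpace ℝ (Fin n)) = n := by simp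
  rw [hdim] at hmp
  set G : (Metric.sphere (0 : EuclideanSpace ℝ (Fin n)) 1) × (Ioi (0:ℝ)) → ENNReal :=
    fun p => F ((p.2 : ℝ) • (p.1 : EuclideanSpace ℝ (Fin n))) with hG
  have hGm : Measurable G := by
    refine hF.comp ?_
    exact (measurable_subtype_coe.comp measurable_snd).smul
      (measurable_subtype_coe.comp measurable_fst)
  calc ∫⁻ x, F x ∂μ = ∫⁻ x : ({(0)}ᶜ : Set (EuclideanSpace ℝ (Fin n))), F x ∂(μ.comap (↑)) := by
        rw [lintegral_subtype_comap (measurableSet_singleton _).compl, restrict_compl_singleton]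
    _ = ∫⁻ x : ({(0)}ᶜ : Set (EuclideanSpace ℝ (Fin n))),
          G (homeomorphUnitSphereProd _ x) ∂(μ.comap (↑)) := by
        refine lintegral_congr fun x => ?_
        have hx : ‖(x : EuclideanSpace ℝ (Fin n))‖ ≠ 0 := norm_ne_zero_iff.2 x.2
        simp [hG, smul_smul, hx]
    _ = ∫⁻ p, G p ∂(μ.toSphere.prod (Measure.volumeIoiPow (n - 1))) := hmp.lintegral_comp hGm
    _ = ∫⁻ θ, ∫⁻ r, G (θ, r) ∂(Measure.volumeIoiPow (n - 1)) ∂μ.toSphere :=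
        lintegral_prod _ hGm.aemeasurable
    _ = _ := by
        refine lintegral_congr fun θ => ?_
        have hGθ : Measurable fun r : Ioi (0:ℝ) => G (θ, r) := hGm.comp measurable_prodMk_left
        rw [Measure.volumeIoiPow, lintegral_withDensity_eq_lintegral_mul _ (by fun_prop) hGθ]
        exact lintegral_subtype_comap measurableSet_Ioi
          (fun r : ℝ => ENNReal.ofReal (r ^ (n - 1)) * F (r • (θ : EuclideanSpace ℝ (Fin n))))

lemma cov_inner (n : ℕ) (hn : 1 ≤ n) (P c : ℝ) (hP : 0 ≤ P) (hc : 0 < c) :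
    ∫⁻ r in Ioi (0:ℝ), ENNReal.ofReal (r ^ (n - 1)) * {r : ℝ | c * r ^ n ≤ P}.indicator 1 r ≤
      ENNReal.ofReal (P / (c * n)) := by
  have hn0 : n ≠ 0 := by omega
  set ρ := (P / c) ^ ((n:ℝ)⁻¹) with hρ
  have hPc : 0 ≤ P / c := by positivity
  have hρ0 : 0 ≤ ρ := Real.rpow_nonneg hPc _
  have hρn : ρ ^ n = P / c := Real.rpow_inv_natCast_pow hPc hn0
  calc ∫⁻ r in Ioi (0:ℝ), ENNReal.ofReal (r ^ (n - 1)) * {r : ℝ | c * r ^ n ≤ P}.indicator 1 r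
      ≤ ∫⁻ r in Ioi (0:ℝ), (Ioc 0 ρ).indicator (fun r => ENNReal.ofReal (r ^ (n - 1))) r := by
        refine setLIntegral_mono' measurableSet_Ioi fun r hr => ?_
        by_cases h : c * r ^ n ≤ P
        · have : r ≤ ρ := by
            refine le_of_pow_le_pow_left₀ hn0 hρ0 ?_
            rw [hρn, le_div_iff₀ hc]; linarith
          rw [indicator_of_mem (show r ∈ Ioc 0 ρ from ⟨hr, this⟩),
            indicator_of_mem (show r ∈ {r : ℝ | c * r ^ n ≤ P} from h)]
          simp
        · rw [indicator_of_notMem (show r ∉ {r : ℝ | c * r ^ n ≤ P} from h)]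
          simp
    _ ≤ ∫⁻ r, (Ioc 0 ρ).indicator (fun r => ENNReal.ofReal (r ^ (n - 1))) r :=
        setLIntegral_le_lintegral _ _
    _ = ∫⁻ r in Ioc 0 ρ, ENNReal.ofReal (r ^ (n - 1)) := lintegral_indicator measurableSet_Ioc _
    _ = ENNReal.ofReal (∫ r in Ioc 0 ρ, r ^ (n - 1)) := by
        rw [ofReal_integral_eq_lintegral_ofReal]
        · exact (Continuous.intervalIntegrable (by fun_prop) 0 ρ).1
        · filter_upwards [ae_restrict_mem measurableSet_Ioc] with y hy
          exact pow_nonneg hy.1.le _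
    _ ≤ ENNReal.ofReal (P / (c * n)) := by
        refine le_of_eq ?_
        congr 1
        rw [← intervalIntegral.integral_of_le hρ0, integral_pow]
        obtain ⟨k, rfl⟩ : ∃ k, n = k + 1 := ⟨n - 1, by omega⟩
        simp only [Nat.add_sub_cancel]
        rw [hρn]
        push_cast
        simp
        field_simp

theorem cov_main {n : ℕ} (hn : 1 ≤ n) (K : Set (EuclideanSpace ℝ (Fin n)))
    (hKcomp : IsCompact K) (hKconv : Convex ℝ K) (hKvol : volume K = 1) :
    (volume (ballBody ((n : ℝ) + 2) (covariogram K))).toReal ≤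
      (Nat.choose (2 * n) n : ℝ) /
        (Nat.choose (2 * n + 2) n : ℝ) ^ ((n : ℝ) / ((n : ℝ) + 2)) := by
  have hK : MeasurableSet K := hKcomp.measurableSet
  have hn0 : n ≠ 0 := by omega
  have hnpos : (0:ℝ) < n := by exact_mod_cast hn
  set g := covariogram K with hg
  have hgm : Measurable g := cov_measurable K hK
  have hfin : ∀ x, volume (K ∩ {y | y - x ∈ K}) ≠ ⊤ := fun x =>
    ne_top_of_le_ne_top (by simp [hKvol]) (measure_mono inter_subset_left)
  have hgof : ∀ x, ENNReal.ofReal (g x) = volume (K ∩ {y | y - x ∈ K}) := fun x =>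
    ENNReal.ofReal_toReal (hfin x)
  have hg0 : ∀ x, 0 ≤ g x := fun x => ENNReal.toReal_nonneg
  have hg1 : ∀ x, g x ≤ 1 := by
    intro x
    refine ENNReal.toReal_le_of_le_ofReal zero_le_one ?_
    rw [ENNReal.ofReal_one, ← hKvol]
    exact measure_mono inter_subset_left
  have hgz : g 0 = 1 := by
    simp [hg, covariogram, hKvol]
  obtain ⟨M, hM⟩ := hKcomp.isBounded.exists_norm_le
  have hsupp : ∀ x, 2 * M < ‖x‖ → g x = 0 := by
    intro x hx
    have : K ∩ {y | y - x ∈ K} = ∅ := by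
      ext y
      simp only [mem_inter_iff, mem_ofPred_eq, mem_empty_iff_false, iff_false, not_and]
      intro h1 h2
      have h3 := norm_sub_le y (y - x)
      rw [sub_sub_cancel] at h3
      linarith [hM _ h1, hM _ h2]
    simp [hg, covariogram, this]
  have hconc : ∀ (x : EuclideanSpace ℝ (Fin n)) (l β : ℝ), 0 < l → l < 1 → 0 < β → g x = β ^ n →
      ((1 - l) + l * β) ^ n ≤ g (l • x) := by
    intro x l β hl0 hl1 hβ hx
    have hmS : ∀ x, MeasurableSet (K ∩ {y | y - x ∈ K}) := fun x =>
      hK.inter ((measurable_id.sub_const x) hK)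
    have := cov_bm K (K ∩ {y | y - x ∈ K}) (K ∩ {y | y - l • x ∈ K}) hK (hmS _) (hmS _) hKvol β hβ
      (by rw [← hgof, hx]) l hl0 hl1 ?_
    · rw [← hgof] at this
      exact (ENNReal.ofReal_le_ofReal_iff (hg0 _)).1 this
    · rintro a ha b ⟨hb, hb'⟩
      have h1 : 0 ≤ 1 - l := by linarith
      refine ⟨hKconv ha hb h1 hl0.le (by ring), ?_⟩
      have := hKconv ha hb' h1 hl0.le (by ring)
      change (1 - l) • a + l • b - l • x ∈ K
      rw [smul_sub] at this
      rwa [add_sub_assoc]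
  have hfm : ∀ x, Measurable fun t : ℝ => g (t • x) := fun x =>
    hgm.comp (measurable_id.smul_const x)
  have hfs : ∀ x, x ≠ 0 → ∀ t, 2 * M / ‖x‖ < t → g (t • x) = 0 := by
    intro x hx t ht
    have hxn : 0 < ‖x‖ := norm_pos_iff.2 hx
    apply hsupp
    rw [norm_smul]
    rw [div_lt_iff₀ hxn] at ht
    exact ht.trans_le (mul_le_mul_of_nonneg_right (le_abs_self t) hxn.le)
  set ψ : EuclideanSpace ℝ (Fin n) → ℝ := fun x => ∫ t in Ioi (0:ℝ), n * (t ^ (n - 1) * g (t • x))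
    with hψ
  have hψm : Measurable ψ := by
    have : Measurable (Function.uncurry fun (x : EuclideanSpace ℝ (Fin n)) (t : ℝ) =>
        (n : ℝ) * (t ^ (n - 1) * g (t • x))) := by
      refine Measurable.const_mul ((measurable_snd.pow_const _).mul (hgm.comp ?_)) _
      exact measurable_snd.smul measurable_fst
    exact (this.stronglyMeasurable.integral_prod_right
      (ν := volume.restrict (Ioi (0:ℝ)))).measurable
  have hC1 : (0:ℝ) < (Nat.choose (2 * n + 2) n : ℝ) := by
    exact_mod_cast Nat.choose_pos (by omega)
  have hC2 : (0:ℝ) < (Nat.choose (2 * n) n : ℝ) := by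
    exact_mod_cast Nat.choose_pos (by omega)
  set c : ℝ := (Nat.choose (2 * n + 2) n : ℝ) ^ ((n : ℝ) / ((n : ℝ) + 2)) /
    (Nat.choose (2 * n) n : ℝ) with hc
  have hc0 : 0 < c := div_pos (Real.rpow_pos_of_pos hC1 _) hC2
  have hsub : ballBody ((n : ℝ) + 2) g ⊆ {x | c ≤ ψ x} ∪ {0} := by
    intro x hx
    by_cases hx0 : x = 0
    · right; exact hx0
    left
    change g 0 ≤ _ at hx
    rw [hgz] at hx
    refine cov_berwald' n hn (fun t => g (t • x)) (hfm x) (fun t => hg0 _) (fun t => hg1 _)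
      (2 * M / ‖x‖) (hfs x hx0) ?_ hx
    intro s t hs hst β hβ hβ'
    have ht : 0 < t := hs.trans hst
    have := hconc (t • x) (s / t) β (div_pos hs ht) ((div_lt_one ht).2 hst) hβ hβ'
    rwa [smul_smul, div_mul_cancel₀ _ ht.ne'] at this
  have hhom : ∀ x (r : ℝ), 0 < r → ψ (r • x) * r ^ n = ψ x := by
    intro x r hr
    have := integral_comp_mul_left_Ioi (fun t => (n:ℝ) * (t ^ (n - 1) * g (t • x))) 0 hr
    rw [mul_zero, smul_eq_mul] at this
    have h2 : ψ x = r * ∫ t in Ioi (0:ℝ), (n:ℝ) * ((r * t) ^ (n - 1) * g ((r * t) • x)) := by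
      rw [this, mul_inv_cancel_left₀ hr.ne']
    rw [h2, hψ, mul_comm, ← integral_const_mul, ← integral_const_mul]
    refine integral_congr_ae (Filter.Eventually.of_forall fun t => ?_)
    simp only [smul_smul]
    obtain ⟨k, hk⟩ : ∃ k, n = k + 1 := ⟨n - 1, by omega⟩
    have hpow : r ^ n = r ^ k * r := by rw [hk, pow_succ]
    rw [show n - 1 = k by omega, hpow, mul_comm t r]
    ring
  have hψi : ∀ x, x ≠ 0 → ENNReal.ofReal (ψ x / n) =
      ∫⁻ t in Ioi (0:ℝ), ENNReal.ofReal (t ^ (n - 1)) * ENNReal.ofReal (g (t • x)) := by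
    intro x hx
    have hintg := cov_f_integrable (fun t => g (t • x)) (hfm x) (fun t => hg0 _) (fun t => hg1 _)
      (2 * M / ‖x‖) (hfs x hx) (n - 1)
    have h1 : ψ x / n = ∫ t in Ioi (0:ℝ), t ^ (n - 1) * g (t • x) := by
      rw [hψ]; simp only
      rw [integral_const_mul, mul_div_cancel_left₀ _ hnpos.ne']
    rw [h1, ofReal_integral_eq_lintegral_ofReal hintg]
    · refine setLIntegral_congr_fun measurableSet_Ioi fun t ht => ?_
      exact ENNReal.ofReal_mul (pow_nonneg (le_of_lt ht) _)
    · filter_upwards [ae_restrict_mem measurableSet_Ioi] with t ht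
      exact mul_nonneg (pow_nonneg (le_of_lt ht) _) (hg0 _)
  have hψ0 : ∀ x, 0 ≤ ψ x := fun x => setIntegral_nonneg measurableSet_Ioi fun t ht =>
    mul_nonneg hnpos.le (mul_nonneg (pow_nonneg (le_of_lt ht) _) (hg0 _))
  have hSm : MeasurableSet {x | c ≤ ψ x} := measurableSet_le measurable_const hψm
  have hvolS : volume {x | c ≤ ψ x} ≤ ENNReal.ofReal c⁻¹ := by
    rw [← lintegral_indicator_one hSm, cov_polar hn _ (measurable_one.indicator hSm)]
    have hT := cov_polar hn (fun x => ENNReal.ofReal (g x)) hgm.ennreal_ofReal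
    rw [cov_lintegral K hK hKvol] at hT
    calc _ ≤ ∫⁻ θ : Metric.sphere (0 : EuclideanSpace ℝ (Fin n)) 1, (ENNReal.ofReal c⁻¹ *
          ∫⁻ r in Ioi (0:ℝ), ENNReal.ofReal (r ^ (n - 1)) *
          ENNReal.ofReal (g (r • (θ : EuclideanSpace ℝ (Fin n)))))
          ∂((volume : Measure (EuclideanSpace ℝ (Fin n))).toSphere) := by
          refine lintegral_mono fun θ => ?_
          have hθ : (θ : EuclideanSpace ℝ (Fin n)) ≠ 0 := by
            have := θ.2
            intro h
            rw [h] at this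
            simp at this
          rw [← hψi _ hθ, ← ENNReal.ofReal_mul (by positivity)]
          have := cov_inner n hn (ψ θ) c (hψ0 _) hc0
          rw [show c⁻¹ * (ψ θ / n) = ψ θ / (c * n) by field_simp]
          refine le_trans (le_of_eq ?_) this
          refine setLIntegral_congr_fun measurableSet_Ioi fun r hr => ?_
          have hr' : 0 < r := hr
          have h2 := hhom (θ : EuclideanSpace ℝ (Fin n)) r hr'
          have : r • (θ : EuclideanSpace ℝ (Fin n)) ∈ {x | c ≤ ψ x} ↔
              r ∈ {r : ℝ | c * r ^ n ≤ ψ θ} := by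
            simp only [mem_ofPred_eq]
            rw [← h2, mul_le_mul_iff_left₀ (pow_pos hr' n)]
          simp only [indicator_apply, this, Pi.one_apply]
      _ = ENNReal.ofReal c⁻¹ * 1 := by
          rw [lintegral_const_mul' _ _ ENNReal.ofReal_ne_top, ← hT]
      _ = _ := mul_one _
  have hv : volume (ballBody ((n : ℝ) + 2) g) ≤ ENNReal.ofReal c⁻¹ := by
    haveI : Nonempty (Fin n) := ⟨⟨0, hn⟩⟩
    refine (measure_mono hsub).trans ((measure_union_le _ _).trans ?_)
    rw [measure_singleton, add_zero]
    exact hvolS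
  refine (ENNReal.toReal_le_of_le_ofReal (by positivity) hv).trans (le_of_eq ?_)
  rw [hc, inv_div]

/-- For a convex body `K ⊆ ℝⁿ` of volume one,
`|K_{n+2}(g_K)| ≤ binom(2n,n) / binom(2n+2,n)^(n/(n+2))`. -/
theorem statement1 {n : ℕ} (hn : 1 ≤ n) (K : Set (EuclideanSpace ℝ (Fin n)))
    (hKcomp : IsCompact K) (hKconv : Convex ℝ K) (hKint : (interior K).Nonempty)
    (hKvol : volume K = 1) :
    (volume (ballBody ((n : ℝ) + 2) (covariogram K))).toReal ≤
      (Nat.choose (2 * n) n : ℝ) /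
        (Nat.choose (2 * n + 2) n : ℝ) ^ ((n : ℝ) / ((n : ℝ) + 2)) := by
  exact cov_main hn K hKcomp hKconv hKvol
end

section
/- Let α > 0 and let g : ℝⁿ → [0,∞) be a continuous integrable α-concave function with g(0) > 0. Then for any 0 < p < q, one has the inclusion ((1/α + q) choose (1/α))^{1/q} · K_q(g) ⊆ ((1/α + p) choose (1/α))^{1/p} · K_p(g). -/
open MeasureTheory Real Set
open scoped RealInnerProductSpace Pointwise

lemma scale_aux (F : ℝ → ℝ) (p l : ℝ) (hl : 0 < l) :
    ∫ t in Ioi (0:ℝ), p * t ^ (p - 1) * F (l * t) =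
      l ^ (-p) * ∫ t in Ioi (0:ℝ), p * t ^ (p - 1) * F t := by
  have h := integral_comp_mul_left_Ioi (fun t => p * t ^ (p - 1) * F t) 0 hl
  rw [mul_zero, smul_eq_mul] at h
  have h2 : ∫ t in Ioi (0:ℝ), p * (l * t) ^ (p - 1) * F (l * t) =
      l ^ (p - 1) * ∫ t in Ioi (0:ℝ), p * t ^ (p - 1) * F (l * t) := by
    rw [← integral_const_mul]
    refine setIntegral_congr_fun measurableSet_Ioi fun t ht => ?_
    have ht : 0 < t := ht
    rw [mul_rpow hl.le ht.le]
    ring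
  rw [h2] at h
  have hpos : 0 < l ^ (p - 1) := rpow_pos_of_pos hl _
  have : l ^ (-p) = l⁻¹ * (l ^ (p - 1))⁻¹ := by
    rw [← rpow_neg hl.le, ← rpow_neg_one l, ← rpow_add hl]
    congr 1; ring
  rw [this]
  field_simp
  field_simp at h
  linarith

lemma beta_one (m p : ℝ) (hm : 0 < m) (hp : 0 < p) :
    ∫ t in Ioi (0:ℝ), p * t ^ (p - 1) * (max 0 (1 - t)) ^ m =
      (gbinom (m + p) m)⁻¹ := by
  have h1 : ∫ t in Ioi (0:ℝ), p * t ^ (p - 1) * (max 0 (1 - t)) ^ m =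
      p * ∫ t in Ioc (0:ℝ) 1, t ^ (p - 1) * (1 - t) ^ (m + 1 - 1) := by
    rw [← integral_const_mul]
    rw [setIntegral_eq_of_subset_of_forall_sdiff_eq_zero (s := Ioc (0:ℝ) 1)
      measurableSet_Ioi Ioc_subset_Ioi_self]
    · refine setIntegral_congr_fun measurableSet_Ioc fun t ht => ?_
      rw [max_eq_right (by linarith [ht.2]), add_sub_cancel_right]
      ring
    · intro t ht
      have : 1 < t := by
        by_contra h
        exact ht.2 ⟨ht.1, not_lt.mp h⟩
      rw [max_eq_left (by linarith), zero_rpow hm.ne', mul_zero]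
  have h2 : ∫ t in Ioc (0:ℝ) 1, t ^ (p - 1) * (1 - t) ^ (m + 1 - 1) =
      ProbabilityTheory.beta p (m + 1) := by
    rw [ProbabilityTheory.beta_eq_betaIntegralReal p (m + 1) hp (by linarith),
      Complex.betaIntegral, intervalIntegral.integral_of_le (by norm_num),
      ← RCLike.re_to_complex, ← integral_re]
    · refine setIntegral_congr_fun measurableSet_Ioc fun x ⟨hx1, hx₂⟩ ↦ ?_
      norm_cast
      rw [← Complex.ofReal_cpow, ← Complex.ofReal_cpow, RCLike.re_to_complex,
        Complex.re_mul_ofReal, Complex.ofReal_re]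
      all_goals linarith
    have := Complex.betaIntegral_convergent (u := (p : ℂ)) (v := ((m + 1 : ℝ) : ℂ)) (by simpa)
      (by rw [Complex.ofReal_re]; linarith)
    rw [intervalIntegrable_iff_integrableOn_Ioc_of_le (by simp), IntegrableOn] at this
    exact this
  rw [h1, h2, ProbabilityTheory.beta, gbinom, inv_div, show 1 + (m + p) - m = p + 1 by ring,
    Real.Gamma_add_one hp.ne', show p + (m + 1) = 1 + (m + p) by ring, add_comm m 1]
  ring

lemma beta_a (m p a : ℝ) (hm : 0 < m) (hp : 0 < p) (ha : 0 < a) :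
    ∫ t in Ioi (0:ℝ), p * t ^ (p - 1) * (max 0 (1 - t / a)) ^ m =
      a ^ p * (gbinom (m + p) m)⁻¹ := by
  have := scale_aux (fun t => (max 0 (1 - t)) ^ m) p a⁻¹ (inv_pos.mpr ha)
  rw [beta_one m p hm hp, inv_rpow ha.le, rpow_neg ha.le, inv_inv] at this
  rw [← this]
  simp only [div_eq_inv_mul]

lemma int_h (m p a : ℝ) (hm : 0 < m) (hp : 0 < p) (ha : 0 < a) :
    IntegrableOn (fun t => p * t ^ (p - 1) * (max 0 (1 - t / a)) ^ m) (Ioi (0:ℝ)) := by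
  by_contra h
  have h1 := integral_undef h
  rw [beta_a m p a hm hp ha] at h1
  have h2 : 0 < gbinom (m + p) m := by
    unfold gbinom
    have := Real.Gamma_pos_of_pos (show 0 < 1 + (m + p) by linarith)
    have := Real.Gamma_pos_of_pos (show 0 < 1 + m by linarith)
    have := Real.Gamma_pos_of_pos (show 0 < 1 + (m + p) - m by linarith)
    positivity
  have h3 := rpow_pos_of_pos ha p
  have : 0 < a ^ p * (gbinom (m + p) m)⁻¹ := by positivity
  linarith

lemma core (α p q a : ℝ) (hα : 0 < α) (hp : 0 < p) (hpq : p < q) (ha : 0 < a)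
    (F : ℝ → ℝ) (hF0 : ∀ t, 0 ≤ F t)
    (hconc : ∀ t, 0 < F t → ∀ s, 0 < s → s < t → 1 - s / t + s / t * F t ^ α ≤ F s ^ α)
    (hIq : IntegrableOn (fun t => q * t ^ (q - 1) * F t) (Ioi 0))
    (hIp : IntegrableOn (fun t => p * t ^ (p - 1) * F t) (Ioi 0))
    (heq : ∫ t in Ioi (0:ℝ), p * t ^ (p - 1) * F t =
      ∫ t in Ioi (0:ℝ), p * t ^ (p - 1) * (max 0 (1 - t / a)) ^ (1 / α)) :
    ∫ t in Ioi (0:ℝ), q * t ^ (q - 1) * F t ≤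
      ∫ t in Ioi (0:ℝ), q * t ^ (q - 1) * (max 0 (1 - t / a)) ^ (1 / α) := by
  have hq : 0 < q := hp.trans hpq
  have hm : 0 < 1 / α := by positivity
  set h : ℝ → ℝ := fun t => (max 0 (1 - t / a)) ^ (1 / α) with hh
  have hJq := int_h (1 / α) q a hm hq ha
  have hJp := int_h (1 / α) p a hm hp ha
  -- comparison criterion
  have cmp : ∀ t, h t < F t ↔ max 0 (1 - t / a) < F t ^ α := by
    intro t
    simp only [hh, one_div]
    exact rpow_inv_lt_iff_of_pos (le_max_left _ _) (hF0 t) hα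
  set A : Set ℝ := {t | 0 < t ∧ h t < F t} with hA
  have Fpos : ∀ t ∈ A, 0 < F t := fun t ht =>
    lt_of_le_of_lt (rpow_nonneg (le_max_left _ _) _) ht.2
  have Adown : ∀ t ∈ A, ∀ s, 0 < s → s < t → s ∈ A := by
    intro t ht s hs hst
    refine ⟨hs, (cmp s).2 ?_⟩
    have h1 := hconc t (Fpos t ht) s hs hst
    have h2 := (cmp t).1 ht.2
    have ht0 : 0 < t := ht.1
    have h3 : 1 - t / a < F t ^ α := lt_of_le_of_lt (le_max_right _ _) h2
    have h4 : 0 < F t ^ α := lt_of_le_of_lt (le_max_left _ _) h2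
    have h5 : s / t < 1 := (div_lt_one ht0).2 hst
    have h6 : 0 < s / t := by positivity
    refine max_lt ?_ ?_
    · nlinarith [mul_pos h6 h4]
    · have : s / a = s / t * (t / a) := by field_simp
      rw [this]
      nlinarith [mul_lt_mul_of_pos_left h3 h6]
  have Abdd : BddAbove A := by
    by_contra hb
    have hge : ∀ s, 0 < s → 1 ≤ F s := by
      intro s hs
      have h1 : 1 ≤ F s ^ α := by
        by_contra! hlt
        obtain ⟨t, ht, hst⟩ := not_bddAbove_iff.1 hb (max s (s / (1 - F s ^ α)))
        have ht1 := lt_of_le_of_lt (le_max_left _ _) hst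
        have ht2 := lt_of_le_of_lt (le_max_right _ _) hst
        have h1 := hconc t (Fpos t ht) s hs ht1
        have ht0 : 0 < t := ht.1
        have h4 : 0 ≤ s / t * F t ^ α := by
          have := rpow_nonneg (hF0 t) α
          positivity
        rw [div_lt_iff₀ (by linarith)] at ht2
        have : s / t < 1 - F s ^ α := by
          rw [div_lt_iff₀ ht0]; linarith
        linarith
      by_contra! hlt
      linarith [rpow_lt_one (hF0 s) hlt hα]
    apply not_integrableOn_Ioi_rpow (q - 1)
    refine Integrable.mono' (hIq.const_mul q⁻¹) ?_ ?_
    · exact (by fun_prop : Measurable fun t : ℝ => t ^ (q - 1)).aestronglyMeasurable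
    · refine (ae_restrict_iff' measurableSet_Ioi).2 (Filter.Eventually.of_forall fun t ht => ?_)
      have ht : 0 < t := ht
      have h1 := rpow_pos_of_pos ht (q - 1)
      rw [Real.norm_of_nonneg h1.le]
      have : q⁻¹ * (q * t ^ (q - 1) * F t) = t ^ (q - 1) * F t := by field_simp
      rw [this]
      nlinarith [hge t ht]
  obtain ⟨t0, ht00, hlow, hhigh⟩ : ∃ t0 : ℝ, 0 ≤ t0 ∧ (∀ t, 0 < t → t < t0 → h t ≤ F t) ∧
      (∀ t, 0 < t → t0 < t → F t ≤ h t) := by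
    refine ⟨sSup A, Real.sSup_nonneg fun t ht => ht.1.le, ?_, ?_⟩
    · intro t ht htA
      rcases A.eq_empty_or_nonempty with he | hne
      · rw [he, Real.sSup_empty] at htA; linarith
      · obtain ⟨u, hu, htu⟩ := exists_lt_of_lt_csSup hne htA
        exact (Adown u hu t ht htu).2.le
    · intro t ht htA
      by_contra! hlt
      exact absurd (le_csSup Abdd ⟨ht, hlt⟩) (not_le.2 htA)
  -- the key nonnegative integrand
  have key : 0 ≤ ∫ t in Ioi (0:ℝ),
      ((q * t ^ (q - 1) * h t - q * t ^ (q - 1) * F t)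
        - q / p * t0 ^ (q - p) * (p * t ^ (p - 1) * h t - p * t ^ (p - 1) * F t)) := by
    refine setIntegral_nonneg measurableSet_Ioi fun t ht => ?_
    have ht : 0 < t := ht
    have e : (q * t ^ (q - 1) * h t - q * t ^ (q - 1) * F t)
        - q / p * t0 ^ (q - p) * (p * t ^ (p - 1) * h t - p * t ^ (p - 1) * F t)
        = q * t ^ (p - 1) * ((t ^ (q - p) - t0 ^ (q - p)) * (h t - F t)) := by
      have : t ^ (q - 1) = t ^ (p - 1) * t ^ (q - p) := by
        rw [← rpow_add ht]; congr 1; ring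
      rw [this]; field_simp
    rw [e]
    have h1 := rpow_pos_of_pos ht (p - 1)
    refine mul_nonneg (by positivity) ?_
    rcases lt_trichotomy t t0 with hlt | heq | hgt
    · have := rpow_le_rpow ht.le hlt.le (sub_pos.2 hpq).le
      exact mul_nonneg_of_nonpos_of_nonpos (by linarith) (by linarith [hlow t ht hlt])
    · simp [heq]
    · have := rpow_le_rpow ht00 hgt.le (sub_pos.2 hpq).le
      exact mul_nonneg (by linarith) (by linarith [hhigh t ht hgt])
  have e1 := integral_sub (hJq.sub hIq) ((hJp.sub hIp).const_mul (q / p * t0 ^ (q - p)))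
  simp only [Pi.sub_apply] at e1
  rw [e1, integral_const_mul, integral_sub hJq hIq, integral_sub hJp hIp, heq, sub_self, mul_zero, sub_zero] at key
  linarith

lemma gbinom_pos' (m p : ℝ) (hm : 0 < m) (hp : 0 < p) : 0 < gbinom (m + p) m := by
  unfold gbinom
  have := Real.Gamma_pos_of_pos (show 0 < 1 + (m + p) by linarith)
  have := Real.Gamma_pos_of_pos (show 0 < 1 + m by linarith)
  have := Real.Gamma_pos_of_pos (show 0 < 1 + (m + p) - m by linarith)
  positivity

lemma oneD (α p q : ℝ) (hα : 0 < α) (hp : 0 < p) (hpq : p < q)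
    (F : ℝ → ℝ) (hFc : Continuous F) (hF0 : ∀ t, 0 ≤ F t)
    (hconc : ∀ t, 0 < F t → ∀ s, 0 < s → s < t → 1 - s / t + s / t * F t ^ α ≤ F s ^ α)
    (hq1 : 1 ≤ ∫ t in Ioi (0:ℝ), q * t ^ (q - 1) * F t) :
    gbinom (1 / α + q) (1 / α) ^ (1 / q) ≤
      (gbinom (1 / α + p) (1 / α) * ∫ t in Ioi (0:ℝ), p * t ^ (p - 1) * F t) ^ (1 / p) := by
  have hq : 0 < q := hp.trans hpq
  have hm : 0 < 1 / α := by positivity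
  have bp := gbinom_pos' (1 / α) p hm hp
  have bq := gbinom_pos' (1 / α) q hm hq
  have hIq : IntegrableOn (fun t => q * t ^ (q - 1) * F t) (Ioi 0) := by
    by_contra h
    have := integral_undef h
    linarith
  have hIp : IntegrableOn (fun t => p * t ^ (p - 1) * F t) (Ioi 0) := by
    rw [← Ioc_union_Ioi_eq_Ioi (zero_le_one' ℝ)]
    refine IntegrableOn.union ?_ ?_
    · have h1 : IntervalIntegrable (fun t : ℝ => t ^ (p - 1)) volume 0 1 :=
        intervalIntegral.intervalIntegrable_rpow' (by linarith)
      have h2 := (h1.const_mul p).mul_continuousOn (hFc.continuousOn (s := uIcc 0 1))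
      rwa [intervalIntegrable_iff_integrableOn_Ioc_of_le (by simp)] at h2
    · have h1 : IntegrableOn (fun t => p / q * (q * t ^ (q - 1) * F t)) (Ioi 1) :=
        (hIq.mono_set (Ioi_subset_Ioi zero_le_one)).const_mul _
      refine Integrable.mono' h1 ?_ ?_
      · have := hFc.measurable
        exact (by fun_prop : Measurable fun t : ℝ => p * t ^ (p - 1) * F t).aestronglyMeasurable
      · refine (ae_restrict_iff' measurableSet_Ioi).2 (Filter.Eventually.of_forall fun t ht => ?_)
        have ht : 1 < t := ht
        have h0 : 0 < t := by linarith
        have e1 := rpow_pos_of_pos h0 (p - 1)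
        have e2 := hF0 t
        rw [Real.norm_of_nonneg (by positivity)]
        have : p / q * (q * t ^ (q - 1) * F t) = p * t ^ (q - 1) * F t := by field_simp
        rw [this]
        have := rpow_le_rpow_of_exponent_le ht.le (show p - 1 ≤ q - 1 by linarith)
        gcongr
  set I := ∫ t in Ioi (0:ℝ), p * t ^ (p - 1) * F t with hI
  have nn : ∀ r : ℝ, 0 < r → 0 ≤ᵐ[volume.restrict (Ioi 0)] fun t : ℝ => r * t ^ (r - 1) * F t := by
    intro r hr
    refine (ae_restrict_iff' measurableSet_Ioi).2 (Filter.Eventually.of_forall fun t ht => ?_)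
    have ht : 0 < t := ht
    have e1 := rpow_pos_of_pos ht (r - 1)
    have e2 := hF0 t
    simp only [Pi.zero_apply]
    positivity
  have Ipos : 0 < I := by
    refine lt_of_le_of_ne (integral_nonneg_of_ae (nn p hp)) fun h0 => ?_
    have h1 := (setIntegral_eq_zero_iff_of_nonneg_ae (nn p hp) hIp).1 h0.symm
    have h2 : ∫ t in Ioi (0:ℝ), q * t ^ (q - 1) * F t = 0 := by
      refine integral_eq_zero_of_ae ?_
      filter_upwards [h1, ae_restrict_mem measurableSet_Ioi] with t h ht
      have ht : 0 < t := ht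
      have e1 := rpow_pos_of_pos ht (p - 1)
      have : F t = 0 := by
        have : p * t ^ (p - 1) ≠ 0 := by positivity
        simpa [this, hp.ne', e1.ne'] using h
      simp [this]
    linarith
  set B := gbinom (1 / α + p) (1 / α) * I with hB
  have Bpos : 0 < B := mul_pos bp Ipos
  have hc := core α p q (B ^ (1 / p)) hα hp hpq (rpow_pos_of_pos Bpos _) F hF0 hconc hIq hIp (by
    rw [beta_a _ _ _ hm hp (rpow_pos_of_pos Bpos _), ← rpow_mul Bpos.le, one_div_mul_cancel hp.ne',
      rpow_one, hB, mul_comm _ I, mul_inv_cancel_right₀ bp.ne'])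
  rw [beta_a _ _ _ hm hq (rpow_pos_of_pos Bpos _)] at hc
  have h3 := hq1.trans hc
  rw [← div_eq_mul_inv, one_le_div bq] at h3
  calc gbinom (1 / α + q) (1 / α) ^ (1 / q) ≤ ((B ^ (1 / p)) ^ q) ^ (1 / q) :=
        rpow_le_rpow bq.le h3 (by positivity)
    _ = B ^ (1 / p) := by
        rw [← rpow_mul (rpow_nonneg Bpos.le _), mul_one_div_cancel hq.ne', rpow_one]

/-- (Theorem `thm:inlcusioninversain`, inclusion part.) If `g : ℝⁿ → [0,∞)`
is a continuous integrable `α`-concave function with `g(0) > 0`, then for `0 < p < q`,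
`((1/α+q) choose (1/α))^(1/q) • K_q(g) ⊆ ((1/α+p) choose (1/α))^(1/p) • K_p(g)`. -/
theorem statement2 {n : ℕ} (α : ℝ) (hα : 0 < α) (g : EuclideanSpace ℝ (Fin n) → ℝ)
    (hgcont : Continuous g) (hgint : Integrable g) (hgnonneg : ∀ x, 0 ≤ g x)
    (hg0 : 0 < g 0)
    (hgconc : ConcaveOn ℝ {x | 0 < g x} (fun x => g x ^ α))
    (p q : ℝ) (hp : 0 < p) (hpq : p < q) :
    (gbinom (1 / α + q) (1 / α) ^ (1 / q)) • ballBody q g ⊆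
      (gbinom (1 / α + p) (1 / α) ^ (1 / p)) • ballBody p g := by
  have hq : 0 < q := hp.trans hpq
  have hm : 0 < 1 / α := by positivity
  have bp := gbinom_pos' (1 / α) p hm hp
  have bq := gbinom_pos' (1 / α) q hm hq
  rintro _ ⟨x, hx, rfl⟩
  have hx : g 0 ≤ ∫ t in Ioi (0:ℝ), q * t ^ (q - 1) * g (t • x) := hx
  have resc : ∀ r : ℝ, ∫ t in Ioi (0:ℝ), r * t ^ (r - 1) * (g (t • x) / g 0) =
      (∫ t in Ioi (0:ℝ), r * t ^ (r - 1) * g (t • x)) / g 0 := by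
    intro r
    rw [← integral_div]
    simp only [mul_div_assoc]
  have h1 := oneD α p q hα hp hpq (fun t => g (t • x) / g 0) (by fun_prop)
    (fun t => div_nonneg (hgnonneg _) hg0.le) (by
      intro t ht s hs hst
      have ht0 : 0 < t := hs.trans hst
      have hgt : 0 < g (t • x) := by
        by_contra! h
        exact absurd ht (not_lt.2 (div_nonpos_of_nonpos_of_nonneg h hg0.le))
      have hst1 : s / t < 1 := (div_lt_one ht0).2 hst
      have hs0 : 0 ≤ s / t := by positivity
      have h2 := hgconc.2 (show (0 : EuclideanSpace ℝ (Fin n)) ∈ {x | 0 < g x} from hg0)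
        (show t • x ∈ {x | 0 < g x} from hgt) (show 0 ≤ 1 - s / t by linarith) hs0 (by ring)
      have e : (1 - s / t) • (0 : EuclideanSpace ℝ (Fin n)) + (s / t) • t • x = s • x := by
        rw [smul_zero, zero_add, smul_smul, div_mul_cancel₀ _ ht0.ne']
      rw [e] at h2
      simp only [smul_eq_mul] at h2
      have h3 := rpow_pos_of_pos hg0 α
      rw [div_rpow hgt.le hg0.le, div_rpow (hgnonneg _) hg0.le, le_div_iff₀ h3]
      have : (1 - s / t + s / t * (g (t • x) ^ α / g 0 ^ α)) * g 0 ^ α =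
        (1 - s / t) * g 0 ^ α + s / t * g (t • x) ^ α := by field_simp
      rw [this]
      exact h2) (by rw [resc, one_le_div hg0]; exact hx)
  rw [resc] at h1
  set I := ∫ t in Ioi (0:ℝ), p * t ^ (p - 1) * g (t • x) with hI
  set b := gbinom (1 / α + p) (1 / α) with hb
  set c := gbinom (1 / α + q) (1 / α) with hc
  have cq : 0 < c ^ (1 / q) := rpow_pos_of_pos bq _
  have cp : 0 < b ^ (1 / p) := rpow_pos_of_pos bp _
  have I0 : 0 ≤ I := setIntegral_nonneg measurableSet_Ioi fun t ht => by
    have ht : 0 < t := ht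
    have := rpow_pos_of_pos ht (p - 1)
    have := hgnonneg (t • x)
    positivity
  set l := c ^ (1 / q) / b ^ (1 / p) with hl
  have lpos : 0 < l := div_pos cq cp
  refine ⟨l • x, ?_, ?_⟩
  · change g 0 ≤ ∫ t in Ioi (0:ℝ), p * t ^ (p - 1) * g (t • l • x)
    have h2 := scale_aux (fun t => g (t • x)) p l lpos
    have h3 : ∀ t : ℝ, t • l • x = (l * t) • x := fun t => by rw [smul_smul, mul_comm]
    simp only [h3]
    rw [h2, ← hI]
    have h4 : l ≤ (I / g 0) ^ (1 / p) := by
      rw [hl, div_le_iff₀ cp, mul_comm, ← mul_rpow bp.le (by positivity)]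
      exact h1
    have h5 : l ^ p ≤ I / g 0 := by
      calc l ^ p ≤ ((I / g 0) ^ (1 / p)) ^ p := rpow_le_rpow lpos.le h4 hp.le
        _ = I / g 0 := by
          rw [← rpow_mul (by positivity), one_div_mul_cancel hp.ne', rpow_one]
    rw [le_div_iff₀ hg0] at h5
    rw [rpow_neg lpos.le, inv_mul_eq_div, le_div_iff₀ (rpow_pos_of_pos lpos _), mul_comm]
    exact h5
  · simp only [smul_smul]
    rw [hl, mul_div_cancel₀ _ cp.ne']
end

section
/- Let α > 0 and let g : ℝⁿ → [0,∞) be a continuous integrable α-concave function with g(0) > 0. If there exist 0 < p < q such that ((1/α + q) choose (1/α))^{1/q} · K_q(g) = ((1/α + p) choose (1/α))^{1/p} · K_p(g), then sup g = g(0) and g(x)/g(0) = (1 − ‖x‖_L)^{1/α} for all x in L and g(x) = 0 for x outside L, where L is the support of g and ‖·‖_L denotes the Minkowski functional (gauge) of L. -/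
open MeasureTheory Real Set
open scoped RealInnerProductSpace Pointwise

lemma aux_intg {p T : ℝ} (hp : 0 < p) (hT : 0 ≤ T) {h : ℝ → ℝ} (hc : Continuous h)
    (hz : ∀ t, T ≤ t → h t = 0) :
    IntegrableOn (fun t => p * t ^ (p - 1) * h t) (Ioi 0) := by
  have h1 : IntegrableOn (fun t => p * t ^ (p - 1) * h t) (Ioc 0 T) := by
    rw [← intervalIntegrable_iff_integrableOn_Ioc_of_le hT]
    have := (intervalIntegral.intervalIntegrable_rpow' (a := 0) (b := T) (r := p - 1)
      (by linarith)).const_mul p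
    exact this.mul_continuousOn hc.continuousOn
  have h2 : IntegrableOn (fun t => p * t ^ (p - 1) * h t) (Ioi T) := by
    refine (integrableOn_zero).congr_fun ?_ measurableSet_Ioi
    intro t ht
    simp [hz t (le_of_lt ht)]
  rw [← Ioc_union_Ioi_eq_Ioi hT]
  exact h1.union h2

lemma aux_scale {p c : ℝ} (hc : 0 < c) (h : ℝ → ℝ) :
    ∫ t in Ioi (0:ℝ), p * t ^ (p - 1) * h (c * t) =
      c ^ (-p) * ∫ t in Ioi (0:ℝ), p * t ^ (p - 1) * h t := by
  have h1 := integral_comp_mul_left_Ioi (fun t => p * t ^ (p - 1) * h t) 0 hc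
  rw [mul_zero] at h1
  have h2 : ∫ t in Ioi (0:ℝ), p * t ^ (p - 1) * h (c * t) =
      ∫ t in Ioi (0:ℝ), c ^ (1 - p) * (p * (c * t) ^ (p - 1) * h (c * t)) := by
    refine setIntegral_congr_fun measurableSet_Ioi ?_
    intro t ht
    have ht : 0 < t := ht
    simp only
    rw [Real.mul_rpow hc.le ht.le]
    have : c ^ (1 - p) * c ^ (p - 1) = 1 := by
      rw [← Real.rpow_add hc]; simp
    calc p * t ^ (p - 1) * h (c * t) = (c ^ (1 - p) * c ^ (p - 1)) * (p * t ^ (p - 1) * h (c * t)) := by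
          rw [this, one_mul]
      _ = _ := by ring
  rw [h2, integral_const_mul, h1, smul_eq_mul, ← mul_assoc]
  congr 1
  rw [← Real.rpow_neg_one c, ← Real.rpow_add hc]
  congr 1; ring

lemma aux_gbinom_pos {a p : ℝ} (ha : 0 < a) (hp : 0 < p) : 0 < gbinom (a + p) a := by
  unfold gbinom
  have h1 := Real.Gamma_pos_of_pos (show 0 < 1 + (a + p) by linarith)
  have h2 := Real.Gamma_pos_of_pos (show 0 < 1 + a by linarith)
  have h3 := Real.Gamma_pos_of_pos (show 0 < 1 + (a + p) - a by linarith)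
  positivity

lemma aux_beta {a p : ℝ} (ha : 0 < a) (hp : 0 < p) :
    gbinom (a + p) a * ∫ t in Ioi (0:ℝ), p * t ^ (p - 1) * (max 0 (1 - t)) ^ a = 1 := by
  have e1 : ∫ t in Ioi (0:ℝ), p * t ^ (p - 1) * (max 0 (1 - t)) ^ a =
      p * ∫ t in (0:ℝ)..1, t ^ (p - 1) * (1 - t) ^ a := by
    rw [intervalIntegral.integral_of_le zero_le_one, ← integral_const_mul,
      setIntegral_eq_of_subset_of_forall_sdiff_eq_zero (s := Ioc (0:ℝ) 1) measurableSet_Ioi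
        Ioc_subset_Ioi_self]
    · refine setIntegral_congr_fun measurableSet_Ioc ?_
      intro t ht
      simp only
      rw [max_eq_right (by linarith [ht.2]), mul_assoc]
    · intro t ht
      have h0 : 0 < t := ht.1
      have : 1 < t := by
        by_contra hh
        exact ht.2 ⟨h0, not_lt.mp hh⟩
      rw [max_eq_left (by linarith), Real.zero_rpow ha.ne', mul_zero]
  have e2 : ∫ t in (0:ℝ)..1, t ^ (p - 1) * (1 - t) ^ a = ProbabilityTheory.beta p (a + 1) := by
    rw [ProbabilityTheory.beta_eq_betaIntegralReal p (a+1) hp (by linarith)]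
    have : Complex.betaIntegral (p:ℂ) ((a+1 : ℝ):ℂ) =
        ((∫ t in (0:ℝ)..1, t ^ (p - 1) * (1 - t) ^ a : ℝ) : ℂ) := by
      rw [Complex.betaIntegral, ← intervalIntegral.integral_ofReal]
      refine intervalIntegral.integral_congr ?_
      intro t ht
      rw [uIcc_of_le zero_le_one] at ht
      simp only
      push_cast
      rw [Complex.ofReal_cpow ht.1, Complex.ofReal_cpow (by linarith [ht.2])]
      push_cast
      ring_nf
    rw [this, Complex.ofReal_re]
  rw [e1, e2, ProbabilityTheory.beta, gbinom]
  have h1 := (Real.Gamma_pos_of_pos (show 0 < 1 + (a + p) by linarith)).ne'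
  have h2 := (Real.Gamma_pos_of_pos (show 0 < 1 + a by linarith)).ne'
  have h3 := (Real.Gamma_pos_of_pos hp).ne'
  rw [show 1 + (a + p) - a = p + 1 by ring, Real.Gamma_add_one hp.ne',
    show p + (a + 1) = 1 + (a + p) by ring, show a + 1 = 1 + a by ring]
  field_simp

lemma aux_one_dim {α : ℝ} (hα : 0 < α) {p q : ℝ} (hp : 0 < p) (hpq : p < q)
    {h : ℝ → ℝ} (hc : Continuous h) (hnn : ∀ t, 0 ≤ h t) {T : ℝ} (hT : 0 < T)
    (hz : ∀ t, T ≤ t → h t = 0)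
    (hconc : ∀ t s, 0 < t → t < s → 0 < h s → (1 - t / s) + (t / s) * h s ^ α ≤ h t ^ α)
    {R : ℝ} (hR : 0 < R)
    (hmp : gbinom (1 / α + p) (1 / α) * (∫ t in Ioi (0:ℝ), p * t ^ (p - 1) * h t) = R ^ p)
    (hmq : gbinom (1 / α + q) (1 / α) * (∫ t in Ioi (0:ℝ), q * t ^ (q - 1) * h t) = R ^ q) :
    ∀ t, 0 < t → h t = (max 0 (1 - t / R)) ^ (1 / α) := by
  have ha : 0 < 1 / α := by positivity
  have hq : 0 < q := hp.trans hpq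
  set ψ : ℝ → ℝ := fun t => (max 0 (1 - t / R)) ^ (1 / α) with hψ
  have hψc : Continuous ψ := by
    refine Continuous.rpow_const (by fun_prop) ?_
    intro t; right; exact ha.le
  have hψz : ∀ t, R ≤ t → ψ t = 0 := by
    intro t ht
    have : 1 ≤ t / R := by rwa [le_div_iff₀ hR, one_mul]
    simp only [hψ]
    rw [max_eq_left (by linarith), Real.zero_rpow ha.ne']
  have hψnn : ∀ t, 0 ≤ ψ t := fun t => Real.rpow_nonneg (le_max_left _ _) _
  have hψα : ∀ t, ψ t ^ α = max 0 (1 - t / R) := by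
    intro t
    simp only [hψ]
    rw [← Real.rpow_mul (le_max_left _ _), one_div_mul_cancel hα.ne', Real.rpow_one]
  -- moments agree
  have hψm : ∀ r, 0 < r →
      gbinom (1 / α + r) (1 / α) * (∫ t in Ioi (0:ℝ), r * t ^ (r - 1) * ψ t) = R ^ r := by
    intro r hr
    have h1 := aux_scale (p := r) (inv_pos.mpr hR) (fun t => (max 0 (1 - t)) ^ (1 / α))
    have h2 : (fun t => r * t ^ (r - 1) * ψ t) =
        fun t => r * t ^ (r - 1) * (max 0 (1 - R⁻¹ * t)) ^ (1 / α) := by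
      funext t; simp only [hψ]; rw [div_eq_inv_mul t R]
    rw [h2, h1, mul_left_comm, aux_beta ha hr, mul_one, Real.inv_rpow hR.le, Real.rpow_neg hR.le,
      inv_inv]
  have hmom : ∀ r, 0 < r →
      gbinom (1 / α + r) (1 / α) * (∫ t in Ioi (0:ℝ), r * t ^ (r - 1) * h t) = R ^ r →
      ∫ t in Ioi (0:ℝ), r * t ^ (r - 1) * (h t - ψ t) = 0 := by
    intro r hr hm
    have hb := aux_gbinom_pos ha hr
    have := mul_left_cancel₀ hb.ne' (hm.trans (hψm r hr).symm)
    simp only [mul_sub]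
    rw [integral_sub (aux_intg hr hT.le hc hz) (aux_intg hr hR.le hψc hψz), this, sub_self]
  have hDp := hmom p hp hmp
  have hDq := hmom q hq hmq
  have hDc : Continuous (fun t => h t - ψ t) := hc.sub hψc
  have hDz : ∀ t, max T R ≤ t → h t - ψ t = 0 := by
    intro t ht
    rw [hz t (le_trans (le_max_left _ _) ht), hψz t (le_trans (le_max_right _ _) ht), sub_self]
  have hDip := aux_intg hp (hT.le.trans (le_max_left T R)) hDc hDz
  have hDiq := aux_intg hq (hT.le.trans (le_max_left T R)) hDc hDz
  -- single crossing
  have hcross : ∀ t s, 0 < t → t < s → ψ s < h s → ψ t ≤ h t := by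
    intro t s ht hts hs
    have hs0 : 0 < s := ht.trans hts
    have hhs : 0 < h s := (hψnn s).trans_lt hs
    rw [← Real.rpow_le_rpow_iff (hψnn t) (hnn t) hα, hψα]
    have h1 := hconc t s ht hts hhs
    have h2 : 1 - s / R ≤ h s ^ α := by
      have := Real.rpow_le_rpow (hψnn s) hs.le hα.le
      rw [hψα] at this
      exact (le_max_right _ _).trans this
    refine max_le (Real.rpow_nonneg (hnn t) _) (le_trans ?_ h1)
    have h3 : (t / s) * (1 - s / R) ≤ (t / s) * h s ^ α :=
      mul_le_mul_of_nonneg_left h2 (by positivity)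
    have h4 : (t / s) * (1 - s / R) = t / s - t / R := by field_simp
    linarith
  set S : Set ℝ := {s | 0 < s ∧ ψ s < h s} with hS
  have hSbdd : BddAbove S := by
    refine ⟨T, ?_⟩
    rintro s ⟨_, hs⟩
    by_contra hh
    rw [hz s (not_le.mp hh).le] at hs
    exact absurd (hψnn s) (not_le.mpr hs)
  set t0 := sSup S with ht0
  have ht0nn : 0 ≤ t0 := Real.sSup_nonneg (fun s hs => hs.1.le)
  have hlow : ∀ t, 0 < t → t < t0 → 0 ≤ h t - ψ t := by
    intro t ht htt
    have hne : S.Nonempty := by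
      by_contra hh
      rw [Set.not_nonempty_iff_eq_empty] at hh
      rw [ht0, hh, Real.sSup_empty] at htt
      linarith
    obtain ⟨s, hs, hts⟩ := exists_lt_of_lt_csSup hne htt
    linarith [hcross t s ht hts hs.2]
  have hhigh : ∀ t, 0 < t → t0 < t → h t - ψ t ≤ 0 := by
    intro t ht htt
    by_contra hh
    have : t ∈ S := ⟨ht, by linarith⟩
    linarith [le_csSup hSbdd this]
  -- the signed integrand
  set F : ℝ → ℝ := fun t => t ^ (p - 1) * (t0 ^ (q - p) - t ^ (q - p)) * (h t - ψ t) with hF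
  have hqp : 0 < q - p := by linarith
  have hFnn : ∀ t ∈ Ioi (0:ℝ), 0 ≤ F t := by
    intro t ht
    have ht : 0 < t := ht
    have h1 : 0 < t ^ (p - 1) := Real.rpow_pos_of_pos ht _
    simp only [hF]
    rw [mul_assoc]
    refine mul_nonneg h1.le ?_
    rcases lt_trichotomy t t0 with hlt | heq | hgt
    · exact mul_nonneg (by linarith [Real.rpow_le_rpow ht.le hlt.le hqp.le]) (hlow t ht hlt)
    · simp [heq]
    · exact mul_nonneg_of_nonpos_of_nonpos (by linarith [Real.rpow_le_rpow ht0nn hgt.le hqp.le])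
        (hhigh t ht hgt)
  have hFeq : EqOn F (fun t => (t0 ^ (q - p) / p) * (p * t ^ (p - 1) * (h t - ψ t)) -
      (1 / q) * (q * t ^ (q - 1) * (h t - ψ t))) (Ioi 0) := by
    intro t ht
    have ht : 0 < t := ht
    have : t ^ (q - 1) = t ^ (p - 1) * t ^ (q - p) := by
      rw [← Real.rpow_add ht]; congr 1; ring
    simp only [hF]
    rw [this]
    field_simp
    try ring
  have hFint : IntegrableOn F (Ioi 0) :=
    IntegrableOn.congr_fun ((hDip.const_mul _).sub (hDiq.const_mul _)) hFeq.symm measurableSet_Ioi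
  have hF0 : ∫ t in Ioi (0:ℝ), F t = 0 := by
    rw [setIntegral_congr_fun measurableSet_Ioi hFeq,
      integral_sub (hDip.const_mul _) (hDiq.const_mul _), integral_const_mul, integral_const_mul,
      hDp, hDq]
    simp
  have hae : F =ᵐ[volume.restrict (Ioi 0)] 0 := by
    rw [← integral_eq_zero_iff_of_nonneg_ae _ hFint]
    · exact hF0
    · exact (ae_restrict_iff' measurableSet_Ioi).mpr (Filter.Eventually.of_forall hFnn)
  have hae2 : h =ᵐ[volume.restrict (Ioi 0)] ψ := by
    have hne : ∀ᵐ t ∂(volume.restrict (Ioi (0:ℝ))), t ≠ t0 :=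
      ae_restrict_of_ae (by simp [ae_iff, measure_singleton])
    filter_upwards [hae, hne, ae_restrict_mem measurableSet_Ioi] with t h1 h2 h3
    have h3 : 0 < t := h3
    simp only [hF, Pi.zero_apply, mul_eq_zero] at h1
    rcases h1 with (h1 | h1) | h1
    · exact absurd h1 (Real.rpow_pos_of_pos h3 _).ne'
    · exact absurd ((Real.rpow_left_inj ht0nn h3.le hqp.ne').mp (sub_eq_zero.mp h1)) h2.symm
    · exact sub_eq_zero.mp h1
  have := Measure.eqOn_of_ae_eq hae2 hc.continuousOn hψc.continuousOn
    (by rw [interior_Ioi]; exact subset_closure)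
  intro t ht
  exact this ht

lemma aux_ray {n : ℕ} {α : ℝ} (hα : 0 < α) {g : EuclideanSpace ℝ (Fin n) → ℝ}
    (hgcont : Continuous g) (hgint : Integrable g) (hgnonneg : ∀ x, 0 ≤ g x)
    (hg0 : 0 < g 0) (hgconc : ConcaveOn ℝ {x | 0 < g x} (fun x => g x ^ α))
    {x : EuclideanSpace ℝ (Fin n)} (hx : x ≠ 0) :
    ∃ T : ℝ, 0 < T ∧ ∀ t, T ≤ t → g (t • x) = 0 := by
  have key : ∃ T : ℝ, 0 < T ∧ g (T • x) = 0 := by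
    by_contra hcon
    push Not at hcon
    have hpos : ∀ t : ℝ, 0 < t → 0 < g (t • x) :=
      fun t ht => lt_of_le_of_ne (hgnonneg _) (hcon t ht).symm
    obtain ⟨r, hr, hball⟩ : ∃ r > 0, ∀ y, dist y (0 : EuclideanSpace ℝ (Fin n)) < r →
        g 0 / 2 < g y := by
      have : ∀ᶠ y in nhds (0 : EuclideanSpace ℝ (Fin n)), g 0 / 2 < g y :=
        hgcont.continuousAt.eventually (lt_mem_nhds (by linarith))
      exact Metric.eventually_nhds_iff.mp this
    set m : ℝ := (1 / 2) * (g 0 / 2) ^ α with hm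
    have hmpos : 0 < m := by positivity
    have hlb : ∀ (y : EuclideanSpace ℝ (Fin n)) (t : ℝ), ‖y‖ < r / 2 → 0 < t →
        m ^ (1 / α) ≤ g (y + t • x) := by
      intro y t hy ht
      have h1 : g 0 / 2 < g ((2:ℝ) • y) := hball _ (by
        rw [dist_zero_right, norm_smul, Real.norm_of_nonneg (by norm_num)]; linarith)
      have h2 := hpos (2 * t) (by linarith)
      have h3 := hgconc.2 (show (2:ℝ) • y ∈ {x | 0 < g x} from by
        show 0 < g _
        linarith) (show (2 * t) • x ∈ {x | 0 < g x} from h2)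
        (show (0:ℝ) ≤ 1 / 2 by norm_num) (show (0:ℝ) ≤ 1 / 2 by norm_num) (by norm_num)
      have h4 : (1 / 2 : ℝ) • (2:ℝ) • y + (1 / 2 : ℝ) • (2 * t) • x = y + t • x := by
        rw [smul_smul, smul_smul, show (1 / 2 : ℝ) * (2 * t) = t by ring]; norm_num
      simp only [h4, smul_eq_mul] at h3
      have h5 : (g 0 / 2) ^ α ≤ g ((2:ℝ) • y) ^ α :=
        Real.rpow_le_rpow (by linarith) h1.le hα.le
      have h6 : 0 ≤ g ((2 * t) • x) ^ α := Real.rpow_nonneg h2.le _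
      have h7 : m ≤ g (y + t • x) ^ α := by rw [hm]; linarith
      have h8 := Real.rpow_le_rpow hmpos.le h7 (show 0 ≤ 1 / α by positivity)
      rwa [← Real.rpow_mul (hgnonneg _), mul_one_div_cancel hα.ne', Real.rpow_one] at h8
    have hfin := hgint.measure_ge_lt_top (ε := m ^ (1 / α)) (Real.rpow_pos_of_pos hmpos _)
    have hxn : 0 < ‖x‖ := norm_pos_iff.mpr hx
    set N : ℝ := r / ‖x‖ with hN
    have hNpos : 0 < N := by positivity
    set B : ℕ → Set (EuclideanSpace ℝ (Fin n)) :=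
      fun k => Metric.ball ((((k:ℝ) + 1) * N) • x) (r / 2) with hB
    have hsub : (⋃ k, B k) ⊆ {a | m ^ (1 / α) ≤ g a} := by
      intro z hz
      obtain ⟨k, hk⟩ := mem_iUnion.mp hz
      have hk : dist z ((((k:ℝ) + 1) * N) • x) < r / 2 := hk
      rw [dist_eq_norm] at hk
      have := hlb (z - (((k:ℝ) + 1) * N) • x) (((k:ℝ) + 1) * N) hk (by positivity)
      rwa [sub_add_cancel] at this
    have hdisj : Pairwise (Function.onFun Disjoint B) := by
      intro k l hkl
      refine Metric.ball_disjoint_ball ?_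
      rw [dist_eq_norm, ← sub_smul, norm_smul, ← sub_mul, norm_mul, Real.norm_of_nonneg hNpos.le,
        mul_assoc, hN, div_mul_cancel₀ _ hxn.ne']
      have h1 : (1:ℝ) ≤ ‖(k:ℝ) + 1 - ((l:ℝ) + 1)‖ := by
        rw [add_sub_add_right_eq_sub, Real.norm_eq_abs]
        have : (1:ℤ) ≤ |(k:ℤ) - (l:ℤ)| := Int.one_le_abs (sub_ne_zero.mpr (by exact_mod_cast hkl))
        exact_mod_cast this
      nlinarith
    have hvol : volume (⋃ k, B k) = ⊤ := by
      rw [measure_iUnion hdisj (fun k => Metric.isOpen_ball.measurableSet)]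
      have : ∀ k, volume (B k) = volume (Metric.ball (0 : EuclideanSpace ℝ (Fin n)) (r / 2)) :=
        fun k => Measure.addHaar_ball_center _ _ _
      simp_rw [this]
      exact ENNReal.tsum_const_eq_top_of_ne_zero
        (Metric.measure_ball_pos volume _ (by linarith)).ne'
    have := (measure_mono hsub).trans_lt hfin
    rw [hvol] at this
    exact lt_irrefl _ this
  obtain ⟨T, hT, hgT⟩ := key
  refine ⟨T, hT, fun t ht => ?_⟩
  by_contra hne
  have hpos : 0 < g (t • x) := lt_of_le_of_ne (hgnonneg _) (Ne.symm hne)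
  have ht0 : 0 < t := hT.trans_le ht
  have hle : T / t ≤ 1 := by rwa [div_le_one ht0]
  have := hgconc.1 (show (0 : EuclideanSpace ℝ (Fin n)) ∈ {x | 0 < g x} from hg0)
    (show t • x ∈ {x | 0 < g x} from hpos)
    (show 0 ≤ 1 - T / t by linarith) (show 0 ≤ T / t by positivity) (by ring)
  rw [smul_zero, zero_add, smul_smul, div_mul_cancel₀ _ ht0.ne'] at this
  have : 0 < g (T • x) := this
  linarith

lemma aux_mem {n : ℕ} {g : EuclideanSpace ℝ (Fin n) → ℝ} (hg0 : 0 < g 0)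
    {x : EuclideanSpace ℝ (Fin n)} {p b : ℝ} (hp : 0 < p) (hb : 0 < b) {c : ℝ} (hc : 0 < c) :
    c • x ∈ (b ^ (1 / p)) • ballBody p g ↔
      c ^ p ≤ b * ∫ t in Ioi (0:ℝ), p * t ^ (p - 1) * (g (t • x) / g 0) := by
  have hA : 0 < b ^ (1 / p) := Real.rpow_pos_of_pos hb _
  rw [mem_smul_set_iff_inv_smul_mem₀ hA.ne', ballBody, mem_ofPred_eq]
  set d : ℝ := (b ^ (1 / p))⁻¹ * c with hd
  have hdpos : 0 < d := by positivity
  have e1 : ∫ t in Ioi (0:ℝ), p * t ^ (p - 1) * g (t • (b ^ (1 / p))⁻¹ • c • x) =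
      g 0 * ∫ t in Ioi (0:ℝ), p * t ^ (p - 1) * (fun s : ℝ => g (s • x) / g 0) (d * t) := by
    rw [← integral_const_mul]
    congr 1
    funext t
    simp only
    rw [smul_smul, smul_smul, show t * (b ^ (1 / p))⁻¹ * c = d * t by rw [hd]; ring]
    field_simp
  rw [e1, aux_scale (p := p) hdpos (fun s : ℝ => g (s • x) / g 0)]
  set I := ∫ t in Ioi (0:ℝ), p * t ^ (p - 1) * (g (t • x) / g 0) with hI
  have e2 : d ^ (-p) = b / c ^ p := by
    rw [hd, Real.mul_rpow (inv_pos.mpr hA).le hc.le, Real.inv_rpow hA.le, Real.rpow_neg hA.le,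
      inv_inv, ← Real.rpow_mul hb.le, one_div_mul_cancel hp.ne', Real.rpow_one,
      Real.rpow_neg hc.le, div_eq_mul_inv]
  rw [e2, le_mul_iff_one_le_right hg0, div_mul_eq_mul_div, le_div_iff₀ (Real.rpow_pos_of_pos hc _),
    one_mul]

lemma aux_pos {p T : ℝ} (hp : 0 < p) (hT : 0 ≤ T) {h : ℝ → ℝ} (hc : Continuous h)
    (hnn : ∀ t, 0 ≤ h t) (h0 : 0 < h 0) (hz : ∀ t, T ≤ t → h t = 0) :
    0 < ∫ t in Ioi (0:ℝ), p * t ^ (p - 1) * h t := by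
  rw [setIntegral_pos_iff_support_of_nonneg_ae _ (aux_intg hp hT hc hz)]
  · obtain ⟨r, hr, hball⟩ : ∃ r > 0, ∀ y, dist y (0 : ℝ) < r → 0 < h y :=
      Metric.eventually_nhds_iff.mp (hc.continuousAt.eventually (lt_mem_nhds h0))
    have hsub : Ioo 0 r ⊆ Function.support (fun t => p * t ^ (p - 1) * h t) ∩ Ioi 0 := by
      intro t ht
      refine ⟨?_, ht.1⟩
      have h1 : 0 < h t := hball t (by
        rw [dist_zero_right, Real.norm_of_nonneg ht.1.le]; exact ht.2)
      have h2 := Real.rpow_pos_of_pos ht.1 (p - 1)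
      exact (mul_pos (mul_pos hp h2) h1).ne'
    refine lt_of_lt_of_le ?_ (measure_mono hsub)
    simpa using hr
  · refine (ae_restrict_iff' measurableSet_Ioi).mpr (Filter.Eventually.of_forall ?_)
    intro t ht
    have h2 := Real.rpow_pos_of_pos (show 0 < t from ht) (p - 1)
    exact mul_nonneg (mul_pos hp h2).le (hnn t)

lemma aux_main {n : ℕ} {α : ℝ} (hα : 0 < α) {g : EuclideanSpace ℝ (Fin n) → ℝ}
    (hgcont : Continuous g) (hgint : Integrable g) (hgnonneg : ∀ x, 0 ≤ g x)
    (hg0 : 0 < g 0)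
    (hgconc : ConcaveOn ℝ {x | 0 < g x} (fun x => g x ^ α))
    {p q : ℝ} (hp : 0 < p) (hpq : p < q)
    (heq : (gbinom (1 / α + q) (1 / α) ^ (1 / q)) • ballBody q g =
      (gbinom (1 / α + p) (1 / α) ^ (1 / p)) • ballBody p g)
    {x : EuclideanSpace ℝ (Fin n)} (hx : x ≠ 0) :
    ∃ R : ℝ, 0 < R ∧ ∀ t, 0 < t → g (t • x) / g 0 = (max 0 (1 - t / R)) ^ (1 / α) := by
  have ha : 0 < 1 / α := by positivity
  have hq : 0 < q := hp.trans hpq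
  obtain ⟨T, hT, hz⟩ := aux_ray hα hgcont hgint hgnonneg hg0 hgconc hx
  set h : ℝ → ℝ := fun t => g (t • x) / g 0 with hh
  have hc : Continuous h := by
    have : Continuous (fun t : ℝ => g (t • x)) := hgcont.comp (by fun_prop)
    exact this.div_const _
  have hnn : ∀ t, 0 ≤ h t := fun t => div_nonneg (hgnonneg _) hg0.le
  have hh0 : h 0 = 1 := by simp [hh, hg0.ne']
  have hhz : ∀ t, T ≤ t → h t = 0 := fun t ht => by simp [hh, hz t ht]
  have hconc : ∀ t s, 0 < t → t < s → 0 < h s →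
      (1 - t / s) + (t / s) * h s ^ α ≤ h t ^ α := by
    intro t s ht hts hs
    have hs0 : 0 < s := ht.trans hts
    have hgs : 0 < g (s • x) := by
      have := mul_pos hs hg0
      simpa [hh, hg0.ne'] using this
    have hle : t / s ≤ 1 := by rw [div_le_one hs0]; exact hts.le
    have := hgconc.2 (show (0 : EuclideanSpace ℝ (Fin n)) ∈ {x | 0 < g x} from hg0)
      (show s • x ∈ {x | 0 < g x} from hgs)
      (show 0 ≤ 1 - t / s by linarith) (show 0 ≤ t / s by positivity) (by ring)
    simp only [smul_zero, zero_add, smul_smul, div_mul_cancel₀ _ hs0.ne', smul_eq_mul] at this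
    have hg0α : 0 < g 0 ^ α := Real.rpow_pos_of_pos hg0 _
    simp only [hh]
    rw [Real.div_rpow (hgnonneg _) hg0.le, Real.div_rpow (hgnonneg _) hg0.le, le_div_iff₀ hg0α]
    refine le_trans (le_of_eq ?_) this
    field_simp
  have hbp := aux_gbinom_pos ha hp
  have hbq := aux_gbinom_pos ha hq
  have hIp := aux_pos hp hT.le hc hnn (by rw [hh0]; exact one_pos) hhz
  have hIq := aux_pos hq hT.le hc hnn (by rw [hh0]; exact one_pos) hhz
  have hiff : ∀ c : ℝ, 0 < c →
      (c ^ q ≤ gbinom (1 / α + q) (1 / α) * (∫ t in Ioi (0:ℝ), q * t ^ (q - 1) * h t) ↔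
       c ^ p ≤ gbinom (1 / α + p) (1 / α) * (∫ t in Ioi (0:ℝ), p * t ^ (p - 1) * h t)) := by
    intro c hc
    rw [← aux_mem hg0 hq hbq hc, ← aux_mem hg0 hp hbp hc, heq]
  set P := gbinom (1 / α + p) (1 / α) * (∫ t in Ioi (0:ℝ), p * t ^ (p - 1) * h t) with hP
  set Q := gbinom (1 / α + q) (1 / α) * (∫ t in Ioi (0:ℝ), q * t ^ (q - 1) * h t) with hQ
  have hPpos : 0 < P := mul_pos hbp hIp
  have hQpos : 0 < Q := mul_pos hbq hIq
  have hRp : 0 < P ^ (1 / p) := Real.rpow_pos_of_pos hPpos _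
  have hRq : 0 < Q ^ (1 / q) := Real.rpow_pos_of_pos hQpos _
  have eP : (P ^ (1 / p)) ^ p = P := by
    rw [← Real.rpow_mul hPpos.le, one_div_mul_cancel hp.ne', Real.rpow_one]
  have eQ : (Q ^ (1 / q)) ^ q = Q := by
    rw [← Real.rpow_mul hQpos.le, one_div_mul_cancel hq.ne', Real.rpow_one]
  have h1 : (P ^ (1 / p)) ^ q ≤ Q := (hiff _ hRp).mpr eP.le
  have h2 : (Q ^ (1 / q)) ^ p ≤ P := (hiff _ hRq).mp eQ.le
  have h3 : Q ^ (1 / q) ≤ P ^ (1 / p) := by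
    rw [← Real.rpow_le_rpow_iff hRq.le hRp.le hp, eP]; exact h2
  have h4 : Q ≤ (P ^ (1 / p)) ^ q := by
    have := Real.rpow_le_rpow hRq.le h3 hq.le
    rwa [eQ] at this
  exact ⟨P ^ (1 / p), hRp, aux_one_dim hα hp hpq hc hnn hT hhz hconc hRp eP.symm
    (le_antisymm h4 h1)⟩

/-- (Theorem `thm:inlcusioninversain`, equality case.) If the inclusion
between the rescaled Ball bodies is an equality for some `0 < p < q`, then `g` attains its
maximum at `0` and `g(x)/g(0) = (1 - ‖x‖_L)^(1/α)` on `L = supp g`, vanishing outside `L`. -/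
theorem statement3 {n : ℕ} (α : ℝ) (hα : 0 < α) (g : EuclideanSpace ℝ (Fin n) → ℝ)
    (hgcont : Continuous g) (hgint : Integrable g) (hgnonneg : ∀ x, 0 ≤ g x)
    (hg0 : 0 < g 0)
    (hgconc : ConcaveOn ℝ {x | 0 < g x} (fun x => g x ^ α))
    (p q : ℝ) (hp : 0 < p) (hpq : p < q)
    (heq : (gbinom (1 / α + q) (1 / α) ^ (1 / q)) • ballBody q g =
      (gbinom (1 / α + p) (1 / α) ^ (1 / p)) • ballBody p g) :
    (∀ x, g x ≤ g 0) ∧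
      (∀ x ∈ closure {y | 0 < g y},
        g x / g 0 = (1 - gauge (closure {y | 0 < g y}) x) ^ (1 / α)) ∧
      (∀ x ∉ closure {y | 0 < g y}, g x = 0) := by
  have ha : 0 < 1 / α := by positivity
  refine ⟨?_, ?_, ?_⟩
  · intro x
    rcases eq_or_ne x 0 with rfl | hx
    · exact le_rfl
    obtain ⟨R, hR, hRx⟩ := aux_main hα hgcont hgint hgnonneg hg0 hgconc hp hpq heq hx
    have h1 := hRx 1 one_pos
    rw [one_smul] at h1
    rw [← div_le_one hg0, h1]
    refine Real.rpow_le_one (le_max_left _ _) (max_le zero_le_one ?_) ha.le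
    have : 0 < 1 / R := by positivity
    linarith
  · intro x hxL
    rcases eq_or_ne x 0 with rfl | hx
    · simp [hg0.ne']
    obtain ⟨R, hR, hRx⟩ := aux_main hα hgcont hgint hgnonneg hg0 hgconc hp hpq heq hx
    have hopen : IsOpen {y | 0 < g y} := isOpen_lt continuous_const hgcont
    have hmemS : ∀ t, 0 < t → t < R → t • x ∈ {y | 0 < g y} := by
      intro t ht htR
      have h1 : t / R < 1 := by rwa [div_lt_one hR]
      have h2 : 0 < g (t • x) / g 0 := by
        rw [hRx t ht]
        exact Real.rpow_pos_of_pos (lt_max_of_lt_right (by linarith)) _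
      exact (div_pos_iff_of_pos_right hg0).mp h2
    have hgR : g (R • x) = 0 := by
      have h1 := hRx R hR
      rw [div_self hR.ne', sub_self, max_self, Real.zero_rpow ha.ne', div_eq_zero_iff] at h1
      exact h1.resolve_right hg0.ne'
    have hmemL : ∀ r, 1 / R < r → 0 < r ∧ r⁻¹ • x ∈ closure {y | 0 < g y} := by
      intro r hr
      have hr0 : 0 < r := lt_trans (by positivity) hr
      refine ⟨hr0, subset_closure (hmemS _ (inv_pos.mpr hr0) ?_)⟩
      rw [inv_lt_comm₀ hr0 hR, ← one_div]
      exact hr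
    have hgauge : gauge (closure {y | 0 < g y}) x = 1 / R := by
      rw [gauge_def']
      refine le_antisymm ?_ ?_
      · refine le_of_forall_gt_imp_ge_of_dense ?_
        intro r hr
        exact csInf_le ⟨0, fun s hs => le_of_lt hs.1⟩ (hmemL r hr)
      · refine le_csInf ⟨1 / R + 1, hmemL _ (by linarith)⟩ ?_
        rintro r ⟨hr0, hr⟩
        have hr0 : 0 < r := hr0
        by_contra hlt
        push Not at hlt
        rw [lt_div_iff₀ hR] at hlt
        have h1 := hgconc.1.openSegment_interior_closure_subset_interior
          (x := 0) (y := r⁻¹ • x) (by rw [hopen.interior_eq]; exact hg0) hr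
        have h2 : R • x ∈ openSegment ℝ 0 (r⁻¹ • x) := by
          refine ⟨1 - r * R, r * R, by linarith, by positivity, by ring, ?_⟩
          rw [smul_zero, zero_add, smul_smul]
          congr 1
          field_simp
        have h3 : R • x ∈ {y | 0 < g y} := interior_subset (h1 h2)
        have h4 : 0 < g (R • x) := h3
        linarith
    have hle := gauge_le_one_of_mem hxL
    have h1 := hRx 1 one_pos
    rw [one_smul] at h1
    rw [h1, hgauge, max_eq_right]
    rw [hgauge] at hle
    linarith
  · intro x hx
    by_contra hne
    exact hx (subset_closure (lt_of_le_of_ne (hgnonneg _) (Ne.symm hne)))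
end

section
/- Let n ≥ 1 and let K ⊆ ℝⁿ be an isotropic convex body with isotropic constant L_K, let g_K be its covariogram, and let T := |K_{n+2}(g_K)|^{-1/n} · K_{n+2}(g_K). Then |T| = 1 and for every unit vector θ ∈ S^{n−1}, ∫_T ⟨x,θ⟩² dx = 2 L_K² / |K_{n+2}(g_K)|^{1+2/n}. -/
open MeasureTheory Real Set
open scoped RealInnerProductSpace Pointwise

open scoped ENNReal

/-- Integration in polar coordinates for nonnegative functions. -/
theorem lintegral_polar14 {n : ℕ} (hn : 1 ≤ n) (f : EuclideanSpace ℝ (Fin n) → ℝ≥0∞)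
    (hf : Measurable f) :
    ∫⁻ x, f x = ∫⁻ ω : Metric.sphere (0 : EuclideanSpace ℝ (Fin n)) 1,
      (∫⁻ r in Ioi (0:ℝ), ENNReal.ofReal (r ^ (n - 1)) * f (r • (ω : EuclideanSpace ℝ (Fin n))))
        ∂((volume : Measure (EuclideanSpace ℝ (Fin n))).toSphere) := by
  have hne : Nontrivial (EuclideanSpace ℝ (Fin n)) := by
    have : Nonempty (Fin n) := ⟨⟨0, hn⟩⟩
    infer_instance
  have h1 : ∫⁻ x, f x = ∫⁻ x : ({(0 : EuclideanSpace ℝ (Fin n))}ᶜ : Set _), f x.1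
      ∂((volume : Measure (EuclideanSpace ℝ (Fin n))).comap (↑)) := by
    rw [lintegral_subtype_comap (measurableSet_singleton _).compl f,
        restrict_compl_singleton]
  have mp := (volume : Measure (EuclideanSpace ℝ (Fin n))).measurePreserving_homeomorphUnitSphereProd
  have hg : Measurable (fun q : Metric.sphere (0 : EuclideanSpace ℝ (Fin n)) 1 × Ioi (0:ℝ) =>
      f (q.2.1 • q.1.1)) := by
    apply hf.comp
    exact (measurable_subtype_coe.comp measurable_snd).smul
      (measurable_subtype_coe.comp measurable_fst)
  have h2 := mp.lintegral_comp hg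
  rw [h1]
  have h3 : ∀ x : ({(0 : EuclideanSpace ℝ (Fin n))}ᶜ : Set _),
      f (((homeomorphUnitSphereProd (EuclideanSpace ℝ (Fin n))) x).2.1 •
       ((homeomorphUnitSphereProd (EuclideanSpace ℝ (Fin n))) x).1.1) = f x.1 := by
    intro x
    have hx : ‖x.1‖ ≠ 0 := norm_ne_zero_iff.mpr x.2
    congr 1
    simp [smul_smul, mul_inv_cancel₀ hx]
  simp only [h3] at h2
  rw [h2, lintegral_prod _ hg.aemeasurable]
  apply lintegral_congr
  intro ω
  have hgω : Measurable (fun y : Ioi (0:ℝ) => f (y.1 • (ω : EuclideanSpace ℝ (Fin n)))) :=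
    hg.comp measurable_prodMk_left
  change ∫⁻ y : Ioi (0:ℝ), f (y.1 • (ω : EuclideanSpace ℝ (Fin n))) ∂_ = _
  rw [Measure.volumeIoiPow, lintegral_withDensity_eq_lintegral_mul _ (by fun_prop) hgω]
  simp only [finrank_euclideanSpace, Fintype.card_fin]
  rw [← lintegral_subtype_comap measurableSet_Ioi]
  rfl

section
variable {n : ℕ} (K : Set (EuclideanSpace ℝ (Fin n)))

theorem covariogram_measurable14 (hK : MeasurableSet K) : Measurable (covariogram K) := by
  apply Measurable.ennreal_toReal
  have hs : MeasurableSet {q : EuclideanSpace ℝ (Fin n) × EuclideanSpace ℝ (Fin n) |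
      q.2 ∈ K ∧ q.2 - q.1 ∈ K} :=
    (measurable_snd hK).inter ((measurable_snd.sub measurable_fst) hK)
  exact measurable_measure_prodMk_left hs

theorem covariogram_nonneg14 (x) : 0 ≤ covariogram K x := ENNReal.toReal_nonneg

theorem covariogram_zero14 (hKvol : volume K = 1) : covariogram K 0 = 1 := by
  simp [covariogram, hKvol]

theorem ofReal_covariogram14 (hKvol : volume K = 1) (x) :
    ENNReal.ofReal (covariogram K x) = volume (K ∩ {y | y - x ∈ K}) := by
  apply ENNReal.ofReal_toReal
  exact (lt_of_le_of_lt (measure_mono inter_subset_left) (by simp [hKvol])).ne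

theorem covariogram_le14 (hKvol : volume K = 1) (x) : covariogram K x ≤ 1 := by
  have : volume (K ∩ {y | y - x ∈ K}) ≤ 1 := hKvol ▸ measure_mono inter_subset_left
  exact ENNReal.toReal_le_of_le_ofReal zero_le_one (by simpa using this)

/-- the radial integral -/
noncomputable def rho14 (x : EuclideanSpace ℝ (Fin n)) : ℝ :=
  ∫ t in Ioi (0:ℝ), t ^ (n + 1) * covariogram K (t • x)

theorem rho_nonneg14 (x) : 0 ≤ rho14 K x := by
  apply setIntegral_nonneg measurableSet_Ioi
  intro t ht
  exact mul_nonneg (pow_nonneg (le_of_lt ht) _) (covariogram_nonneg14 K _)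

theorem mem_ballBody14 (hKvol : volume K = 1) (x) :
    x ∈ ballBody ((n:ℝ) + 2) (covariogram K) ↔ 1 ≤ ((n:ℝ) + 2) * rho14 K x := by
  rw [ballBody, mem_ofPred_eq, covariogram_zero14 K hKvol, rho14, ← integral_const_mul]
  rw [setIntegral_congr_fun measurableSet_Ioi]
  intro t ht
  have : (n:ℝ) + 2 - 1 = ((n + 1 : ℕ) : ℝ) := by push_cast; ring
  simp only [this, Real.rpow_natCast]
  ring

theorem rho_smul14 {r : ℝ} (hr : 0 < r) (x) :
    rho14 K x = r ^ (n + 2) * rho14 K (r • x) := by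
  have h := integral_comp_mul_left_Ioi' (fun t => t ^ (n + 1) * covariogram K (t • x)) 0 hr
  rw [mul_zero] at h
  rw [rho14, ← h, rho14, ← integral_const_mul, smul_eq_mul, ← integral_const_mul]
  congr 1
  ext t
  rw [smul_smul, mul_comm t r]
  ring

theorem rho_measurable14 (hK : MeasurableSet K) : Measurable (rho14 K) := by
  have h : Measurable (fun q : EuclideanSpace ℝ (Fin n) × ℝ =>
      q.2 ^ (n + 1) * covariogram K (q.2 • q.1)) :=
    (measurable_snd.pow_const _).mul
      ((covariogram_measurable14 K hK).comp (measurable_snd.smul measurable_fst))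
  exact (h.stronglyMeasurable.integral_prod_right (ν := volume.restrict (Ioi (0:ℝ)))).measurable

theorem ballBody_measurable14 (hK : MeasurableSet K) (hKvol : volume K = 1) :
    MeasurableSet (ballBody ((n:ℝ) + 2) (covariogram K)) := by
  have : ballBody ((n:ℝ) + 2) (covariogram K) = {x | 1 ≤ ((n:ℝ) + 2) * rho14 K x} := by
    ext x; exact mem_ballBody14 K hKvol x
  rw [this]
  exact measurableSet_le measurable_const ((rho_measurable14 K hK).const_mul _)

theorem rho_integrable14 (hKcomp : IsCompact K) (hKvol : volume K = 1)
    (x : EuclideanSpace ℝ (Fin n)) (hx : ‖x‖ = 1) :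
    IntegrableOn (fun t : ℝ => t ^ (n + 1) * covariogram K (t • x)) (Ioi 0) := by
  obtain ⟨R, hR⟩ := hKcomp.isBounded.subset_closedBall 0
  have hm := (covariogram_measurable14 K hKcomp.measurableSet)
  have hz : ∀ t ∈ Ioi (0:ℝ), t ∉ Ioc 0 (2 * R) → t ^ (n + 1) * covariogram K (t • x) = 0 := by
    intro t ht ht'
    have ht0 : 0 < t := ht
    have h2 : 2 * R < t := by
      by_contra h
      exact ht' ⟨ht0, not_lt.mp h⟩
    have : K ∩ {y | y - t • x ∈ K} = ∅ := by
      apply eq_empty_of_forall_notMem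
      rintro y ⟨hy, hy'⟩
      have a1 : ‖y‖ ≤ R := by simpa using hR hy
      have a2 : ‖y - t • x‖ ≤ R := by simpa using hR hy'
      have a3 : ‖t • x‖ ≤ ‖y‖ + ‖y - t • x‖ := by
        calc ‖t • x‖ = ‖y - (y - t • x)‖ := by congr 1; abel
          _ ≤ _ := norm_sub_le _ _
      rw [norm_smul, hx, Real.norm_of_nonneg ht0.le] at a3
      linarith
    simp [covariogram, this]
  have hi : IntegrableOn (fun t : ℝ => t ^ (n + 1) * covariogram K (t • x)) (Ioc 0 (2*R)) := by
    have h0 : IntegrableOn (fun t : ℝ => t ^ (n + 1)) (Ioc 0 (2*R)) :=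
      ((continuous_pow (n+1)).integrableOn_Icc).mono_set Ioc_subset_Icc_self
    refine h0.mono' ?_ ?_
    · exact ((measurable_id.pow_const _).mul
        (hm.comp (measurable_id.smul_const x))).aestronglyMeasurable
    · filter_upwards [ae_restrict_mem measurableSet_Ioc] with t ht
      have h1 : 0 ≤ t ^ (n+1) := pow_nonneg ht.1.le _
      rw [Real.norm_of_nonneg (mul_nonneg h1 (covariogram_nonneg14 K _))]
      exact mul_le_of_le_one_right h1 (covariogram_le14 K hKvol _)
  exact hi.of_forall_sdiff_eq_zero measurableSet_Ioi (fun t ht => hz t ht.1 ht.2)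

theorem radial14 (n : ℕ) (a : ℝ) (ha : 0 ≤ a) :
    ∫⁻ r in Ioi (0:ℝ), ENNReal.ofReal (r ^ (n + 1)) *
      {r : ℝ | r ^ (n + 2) ≤ ((n:ℝ) + 2) * a}.indicator 1 r = ENNReal.ofReal a := by
  set b : ℝ := (((n:ℝ) + 2) * a) ^ (((n + 2 : ℕ):ℝ)⁻¹) with hb
  have hpa : 0 ≤ ((n:ℝ) + 2) * a := by positivity
  have hb0 : 0 ≤ b := Real.rpow_nonneg hpa _
  have hbp : b ^ (n + 2) = ((n:ℝ) + 2) * a := Real.rpow_inv_natCast_pow hpa (by omega)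
  have h1 : ∀ r ∈ Ioi (0:ℝ), ENNReal.ofReal (r ^ (n + 1)) *
      {r : ℝ | r ^ (n + 2) ≤ ((n:ℝ) + 2) * a}.indicator 1 r =
      (Iic b).indicator (fun r => ENNReal.ofReal (r ^ (n + 1))) r := by
    intro r hr
    have hiff : r ^ (n + 2) ≤ ((n:ℝ) + 2) * a ↔ r ≤ b := by
      rw [← hbp]
      exact pow_le_pow_iff_left₀ (le_of_lt hr) hb0 (by omega)
    by_cases h : r ≤ b
    · simp [indicator, hiff, h]
    · simp [indicator, hiff, h]
  rw [setLIntegral_congr_fun measurableSet_Ioi h1, setLIntegral_indicator measurableSet_Iic,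
    inter_comm, Ioi_inter_Iic,
    ← ofReal_integral_eq_lintegral_ofReal (intervalIntegral.intervalIntegrable_pow _).1,
    ← intervalIntegral.integral_of_le hb0, integral_pow]
  · congr 1
    rw [show n + 1 + 1 = n + 2 by rfl, hbp]
    have : (n:ℝ) + 2 ≠ 0 := by positivity
    push_cast
    field_simp
    simp
    ring
  · filter_upwards [ae_restrict_mem measurableSet_Ioc] with t ht
    exact pow_nonneg ht.1.le _

theorem main_polar14 (hn : 1 ≤ n) (hKcomp : IsCompact K) (hKvol : volume K = 1)
    (θ : EuclideanSpace ℝ (Fin n)) :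
    ∫⁻ x in ballBody ((n:ℝ) + 2) (covariogram K), ENNReal.ofReal (⟪x, θ⟫ ^ 2) =
      ∫⁻ x, ENNReal.ofReal (covariogram K x) * ENNReal.ofReal (⟪x, θ⟫ ^ 2) := by
  have hBm := ballBody_measurable14 K hKcomp.measurableSet hKvol
  have hin : Measurable (fun x : EuclideanSpace ℝ (Fin n) => ENNReal.ofReal (⟪x, θ⟫ ^ 2)) := by
    fun_prop
  rw [← lintegral_indicator hBm, lintegral_polar14 hn _ (hin.indicator hBm),
    lintegral_polar14 hn (fun x => ENNReal.ofReal (covariogram K x) * ENNReal.ofReal (⟪x, θ⟫ ^ 2))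
      ((covariogram_measurable14 K hKcomp.measurableSet).ennreal_ofReal.mul hin)]
  apply lintegral_congr
  intro ω
  have hω : ‖(ω : EuclideanSpace ℝ (Fin n))‖ = 1 := by simpa using ω.2
  have hpow : ∀ r : ℝ, 0 < r → ENNReal.ofReal (r ^ (n - 1)) *
      ENNReal.ofReal (⟪r • (ω : EuclideanSpace ℝ (Fin n)), θ⟫ ^ 2) =
      ENNReal.ofReal (⟪(ω : EuclideanSpace ℝ (Fin n)), θ⟫ ^ 2) * ENNReal.ofReal (r ^ (n + 1)) := by
    intro r hr
    rw [← ENNReal.ofReal_mul (by positivity), ← ENNReal.ofReal_mul (by positivity)]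
    congr 1
    rw [real_inner_smul_left, show n + 1 = n - 1 + 2 by omega, pow_add]
    ring
  trans ENNReal.ofReal (⟪(ω : EuclideanSpace ℝ (Fin n)), θ⟫ ^ 2) * ENNReal.ofReal (rho14 K ω)
  · rw [← radial14 n _ (rho_nonneg14 K ω), ← lintegral_const_mul' _ _ ENNReal.ofReal_ne_top]
    apply setLIntegral_congr_fun measurableSet_Ioi
    intro r hr
    have hr0 : 0 < r := hr
    have hiff : r • (ω : EuclideanSpace ℝ (Fin n)) ∈ ballBody ((n:ℝ) + 2) (covariogram K) ↔
        r ^ (n + 2) ≤ ((n:ℝ) + 2) * rho14 K ω := by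
      rw [mem_ballBody14 K hKvol, rho_smul14 K hr0 (ω : EuclideanSpace ℝ (Fin n)),
        mul_left_comm]
      exact (le_mul_iff_one_le_right (by positivity)).symm
    by_cases h : r ^ (n + 2) ≤ ((n:ℝ) + 2) * rho14 K ω
    · simp [indicator, hiff, h, hpow r hr0]
    · simp [indicator, hiff, h]
  · rw [rho14, ofReal_integral_eq_lintegral_ofReal (rho_integrable14 K hKcomp hKvol _ hω),
      ← lintegral_const_mul' _ _ ENNReal.ofReal_ne_top]
    · apply setLIntegral_congr_fun measurableSet_Ioi
      intro r hr
      have hr0 : 0 < r := hr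
      beta_reduce
      rw [mul_left_comm (ENNReal.ofReal (r ^ (n - 1))), hpow r hr0, ENNReal.ofReal_mul (by positivity)]
      ring
    · filter_upwards [ae_restrict_mem measurableSet_Ioi] with t ht
      exact mul_nonneg (pow_nonneg (le_of_lt ht) _) (covariogram_nonneg14 K _)

theorem second_moment14 (hKcomp : IsCompact K) (hKvol : volume K = 1)
    (hKbar : (∫ x in K, x) = 0) (L : ℝ) (θ : EuclideanSpace ℝ (Fin n))
    (hθ : (∫ x in K, ⟪x, θ⟫ ^ 2) = L ^ 2) :
    ∫⁻ x, ENNReal.ofReal (covariogram K x) * ENNReal.ofReal (⟪x, θ⟫ ^ 2) =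
      ENNReal.ofReal (2 * L ^ 2) := by
  have hKm := hKcomp.measurableSet
  have hfin : IsFiniteMeasure (volume.restrict K) := ⟨by simp [hKvol]⟩
  have hone : (volume.restrict K).real univ = 1 := by simp [Measure.real, hKvol]
  have hi1 : IntegrableOn (fun x : EuclideanSpace ℝ (Fin n) => ⟪x, θ⟫) K :=
    (by fun_prop : Continuous _).continuousOn.integrableOn_compact hKcomp
  have hi2 : IntegrableOn (fun x : EuclideanSpace ℝ (Fin n) => ⟪x, θ⟫ ^ 2) K :=
    (by fun_prop : Continuous _).continuousOn.integrableOn_compact hKcomp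
  have hid : IntegrableOn (fun x : EuclideanSpace ℝ (Fin n) => x) K :=
    continuous_id.continuousOn.integrableOn_compact hKcomp
  have hbar : ∫ x in K, ⟪x, θ⟫ = 0 := by
    have := integral_inner (𝕜 := ℝ) hid θ
    rw [hKbar, inner_zero_right] at this
    rw [← this]
    congr 1
    ext x
    exact real_inner_comm _ _
  let F : EuclideanSpace ℝ (Fin n) → EuclideanSpace ℝ (Fin n) → ℝ≥0∞ := fun x y =>
    K.indicator 1 y * (K.indicator 1 (y - x) * ENNReal.ofReal (⟪x, θ⟫ ^ 2))
  have h1K : Measurable (K.indicator (1 : EuclideanSpace ℝ (Fin n) → ℝ≥0∞)) :=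
    measurable_one.indicator hKm
  have hF : Measurable (Function.uncurry F) := by
    refine (h1K.comp measurable_snd).mul ((h1K.comp (measurable_snd.sub measurable_fst)).mul ?_)
    have : Measurable (fun x : EuclideanSpace ℝ (Fin n) => ENNReal.ofReal (⟪x, θ⟫ ^ 2)) := by
      fun_prop
    exact this.comp measurable_fst
  have e1 : ∀ x, ENNReal.ofReal (covariogram K x) * ENNReal.ofReal (⟪x, θ⟫ ^ 2) = ∫⁻ y, F x y := by
    intro x
    have hs : MeasurableSet (K ∩ {y | y - x ∈ K}) :=
      hKm.inter ((measurable_id.sub_const x) hKm)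
    rw [ofReal_covariogram14 K hKvol, ← lintegral_indicator_one hs,
      ← lintegral_mul_const' _ _ ENNReal.ofReal_ne_top]
    apply lintegral_congr
    intro y
    by_cases a : y ∈ K <;> by_cases b : y - x ∈ K <;> simp [F, indicator, a, b]
  simp_rw [e1]
  rw [lintegral_lintegral_swap hF.aemeasurable]
  have e2 : ∀ y, ∫⁻ x, F x y = K.indicator (fun y => ENNReal.ofReal (⟪y, θ⟫ ^ 2 + L ^ 2)) y := by
    intro y
    by_cases hy : y ∈ K
    swap
    · simp [F, hy]
    have s1 : ∫⁻ x, F x y = ∫⁻ z, K.indicator (fun z => ENNReal.ofReal ((⟪y, θ⟫ - ⟪z, θ⟫) ^ 2)) z := by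
      rw [← lintegral_sub_left_eq_self (fun z => K.indicator
        (fun z => ENNReal.ofReal ((⟪y, θ⟫ - ⟪z, θ⟫) ^ 2)) z) y]
      apply lintegral_congr
      intro x
      by_cases b : y - x ∈ K <;> simp [F, indicator, hy, b, inner_sub_left]
    have hexp : ∀ z : EuclideanSpace ℝ (Fin n), (⟪y, θ⟫ - ⟪z, θ⟫) ^ 2 =
        (⟪y, θ⟫ ^ 2 - 2 * ⟪y, θ⟫ * ⟪z, θ⟫) + ⟪z, θ⟫ ^ 2 := by intro z; ring
    have hc : IntegrableOn (fun z : EuclideanSpace ℝ (Fin n) => ⟪y, θ⟫ ^ 2) K :=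
      integrable_const _
    have hs : IntegrableOn (fun z : EuclideanSpace ℝ (Fin n) =>
        ⟪y, θ⟫ ^ 2 - 2 * ⟪y, θ⟫ * ⟪z, θ⟫) K := hc.sub (hi1.const_mul (2 * ⟪y, θ⟫))
    rw [s1, lintegral_indicator hKm, indicator_of_mem hy,
      ← ofReal_integral_eq_lintegral_ofReal]
    · simp_rw [hexp]
      rw [integral_add hs hi2, integral_sub hc (hi1.const_mul _), integral_const_mul, hbar, hθ,
        integral_const, hone]
      simp
    · simp_rw [hexp]
      exact hs.add hi2
    · exact Filter.Eventually.of_forall fun z => sq_nonneg _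
  simp_rw [e2]
  rw [lintegral_indicator hKm, ← ofReal_integral_eq_lintegral_ofReal]
  · rw [integral_add hi2 (integrable_const _), hθ, integral_const, hone]
    congr 1
    simp
    ring
  · exact hi2.add (integrable_const _)
  · exact Filter.Eventually.of_forall fun z => by positivity

end

/-- For an isotropic convex body `K` with isotropic constant `L`,
the normalized Ball body `T = |K_{n+2}(g_K)|^{-1/n} • K_{n+2}(g_K)` has volume one and
`∫_T ⟨x,θ⟩² dx = 2L² / |K_{n+2}(g_K)|^{1+2/n}` for every unit vector `θ`. -/
theorem statement14 {n : ℕ} (hn : 1 ≤ n) (K : Set (EuclideanSpace ℝ (Fin n)))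
    (hKcomp : IsCompact K) (hKconv : Convex ℝ K) (hKint : (interior K).Nonempty)
    (hKvol : volume K = 1) (hKbar : (∫ x in K, x) = 0)
    (L : ℝ) (hL : 0 < L)
    (hKiso : ∀ θ : EuclideanSpace ℝ (Fin n), ‖θ‖ = 1 → (∫ x in K, ⟪x, θ⟫ ^ 2) = L ^ 2)
    (B : Set (EuclideanSpace ℝ (Fin n))) (hB : B = ballBody ((n : ℝ) + 2) (covariogram K))
    (T : Set (EuclideanSpace ℝ (Fin n)))
    (hT : T = (volume B).toReal ^ (-(1 : ℝ) / (n : ℝ)) • B) :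
    volume T = 1 ∧
      ∀ θ : EuclideanSpace ℝ (Fin n), ‖θ‖ = 1 →
        (∫ x in T, ⟪x, θ⟫ ^ 2) =
          2 * L ^ 2 / (volume B).toReal ^ ((1 : ℝ) + 2 / (n : ℝ)) := by
  have hBm : MeasurableSet B := hB ▸ ballBody_measurable14 K hKcomp.measurableSet hKvol
  have key : ∀ θ : EuclideanSpace ℝ (Fin n), ‖θ‖ = 1 →
      ∫⁻ x in B, ENNReal.ofReal (⟪x, θ⟫ ^ 2) = ENNReal.ofReal (2 * L ^ 2) := by
    intro θ hθ
    rw [hB, main_polar14 K hn hKcomp hKvol, second_moment14 K hKcomp hKvol hKbar L θ (hKiso θ hθ)]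
  have hpos2 : 0 < 2 * L ^ 2 := by positivity
  have hB0 : volume B ≠ 0 := by
    intro h
    have h1 := key (EuclideanSpace.single ⟨0, hn⟩ 1) (by simp)
    rw [Measure.restrict_eq_zero.mpr h, lintegral_zero_measure] at h1
    exact (ENNReal.ofReal_pos.mpr hpos2).ne h1
  have hBtop : volume B ≠ ⊤ := by
    have hle : volume B ≤ volume (Metric.ball (0 : EuclideanSpace ℝ (Fin n)) 1) +
        ∑ i : Fin n, ∫⁻ x in B, ENNReal.ofReal (⟪x, EuclideanSpace.single i (1:ℝ)⟫ ^ 2) := by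
      rw [← lintegral_finsetSum _ (fun i _ => by fun_prop)]
      calc volume B = ∫⁻ x in B, 1 := by simp
        _ ≤ ∫⁻ x in B, ((Metric.ball (0 : EuclideanSpace ℝ (Fin n)) 1).indicator 1 x +
            ∑ i : Fin n, ENNReal.ofReal (⟪x, EuclideanSpace.single i (1:ℝ)⟫ ^ 2)) := by
          apply lintegral_mono
          intro x
          by_cases hx : x ∈ Metric.ball (0 : EuclideanSpace ℝ (Fin n)) 1
          · simp [indicator_of_mem hx]
          · have hx1 : 1 ≤ ‖x‖ := by simpa using hx
            have : ∑ i : Fin n, ENNReal.ofReal (⟪x, EuclideanSpace.single i (1:ℝ)⟫ ^ 2) =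
                ENNReal.ofReal (‖x‖ ^ 2) := by
              rw [← ENNReal.ofReal_sum_of_nonneg (fun i _ => sq_nonneg _),
                EuclideanSpace.real_norm_sq_eq]
              simp [EuclideanSpace.inner_single_right]
            simp only [this, indicator_of_notMem hx, zero_add]
            exact ENNReal.one_le_ofReal.mpr (one_le_pow₀ hx1)
        _ = (∫⁻ x in B, (Metric.ball (0 : EuclideanSpace ℝ (Fin n)) 1).indicator 1 x) +
            ∫⁻ x in B, ∑ i : Fin n, ENNReal.ofReal (⟪x, EuclideanSpace.single i (1:ℝ)⟫ ^ 2) :=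
          lintegral_add_left (measurable_one.indicator measurableSet_ball) _
        _ ≤ _ := by
          gcongr
          refine (setLIntegral_le_lintegral _ _).trans ?_
          rw [lintegral_indicator_one measurableSet_ball]
    refine (lt_of_le_of_lt hle (ENNReal.add_lt_top.mpr ⟨measure_ball_lt_top, ?_⟩)).ne
    refine ENNReal.sum_lt_top.mpr fun i _ => ?_
    rw [key _ (by simp)]
    exact ENNReal.ofReal_lt_top
  set v : ℝ := (volume B).toReal with hv
  have hv0 : 0 < v := ENNReal.toReal_pos hB0 hBtop
  have hnR : (n:ℝ) ≠ 0 := by positivity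
  set c : ℝ := v ^ (-(1 : ℝ) / (n : ℝ)) with hc
  have hc0 : 0 < c := Real.rpow_pos_of_pos hv0 _
  have hcn : c ^ n = v⁻¹ := by
    rw [hc, ← Real.rpow_natCast, ← Real.rpow_mul hv0.le, div_mul_cancel₀ _ hnR, Real.rpow_neg_one]
  constructor
  · rw [hT, Measure.addHaar_smul, finrank_euclideanSpace, Fintype.card_fin, hcn,
      abs_of_pos (inv_pos.mpr hv0), ← ENNReal.ofReal_toReal hBtop, ← hv,
      ← ENNReal.ofReal_mul (inv_pos.mpr hv0).le, inv_mul_cancel₀ hv0.ne', ENNReal.ofReal_one]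
  · intro θ hθ
    have hint : ∫ x in B, ⟪x, θ⟫ ^ 2 = 2 * L ^ 2 := by
      rw [integral_eq_lintegral_of_nonneg_ae (Filter.Eventually.of_forall fun _ => sq_nonneg _)
        (by fun_prop), key θ hθ, ENNReal.toReal_ofReal hpos2.le]
    have h := Measure.setIntegral_comp_smul_of_pos volume
      (fun x : EuclideanSpace ℝ (Fin n) => ⟪x, θ⟫ ^ 2) B hc0
    rw [← hT, finrank_euclideanSpace, Fintype.card_fin, hcn, inv_inv, smul_eq_mul] at h
    simp only [real_inner_smul_left, mul_pow] at h
    rw [integral_const_mul, hint] at h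
    have hc2 : c ^ 2 = (v ^ (2 / (n:ℝ)))⁻¹ := by
      rw [hc, ← Real.rpow_natCast, ← Real.rpow_mul hv0.le, ← Real.rpow_neg hv0.le]
      congr 1
      push_cast
      ring
    rw [hc2] at h
    rw [Real.rpow_add hv0, Real.rpow_one]
    have hw : 0 < v ^ (2 / (n:ℝ)) := Real.rpow_pos_of_pos hv0 _
    rw [eq_div_iff (by positivity), mul_comm v, ← mul_assoc, mul_right_comm, mul_comm _ v, ← h]
    field_simp
end

section
/- For every natural number n ≥ 2, the inequality (4n/(n+2)) · ( n(n+1) / ((n−1)(n+2)) )^{n−1} · n²/(2n−1)² ≥ 1 holds. -/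
/-- (Lemma `mayorque1`.) For every natural number `n ≥ 2`,
`(4n/(n+2)) · (n(n+1)/((n-1)(n+2)))^(n-1) · n²/(2n-1)² ≥ 1`. -/
theorem statement15 (n : ℕ) (hn : 2 ≤ n) :
    1 ≤ (4 * (n : ℝ) / ((n : ℝ) + 2)) *
        ((n : ℝ) * ((n : ℝ) + 1) / (((n : ℝ) - 1) * ((n : ℝ) + 2))) ^ (n - 1) *
        ((n : ℝ) ^ 2 / (2 * (n : ℝ) - 1) ^ 2) := by
  have hx : (2 : ℝ) ≤ n := by exact_mod_cast hn
  have hc : ((n - 1 : ℕ) : ℝ) = (n : ℝ) - 1 := by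
    rw [Nat.cast_sub (by omega)]; simp
  have hb := one_add_mul_le_pow (a := 2 / (((n : ℝ) - 1) * ((n : ℝ) + 2)))
    (by have : 0 ≤ 2 / (((n : ℝ) - 1) * ((n : ℝ) + 2)) :=
          div_nonneg (by norm_num) (mul_nonneg (by linarith) (by linarith))
        linarith) (n - 1)
  rw [hc] at hb
  generalize (n : ℝ) = x at *
  have h1 : x - 1 ≠ 0 := by intro h; linarith
  have h2 : x + 2 ≠ 0 := by intro h; linarith
  have h3 : 0 < 2 * x - 1 := by linarith
  have e1 : x * (x + 1) / ((x - 1) * (x + 2)) = 1 + 2 / ((x - 1) * (x + 2)) := by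
    field_simp; ring
  have e2 : 1 + (x - 1) * (2 / ((x - 1) * (x + 2))) = (x + 4) / (x + 2) := by
    field_simp; ring
  rw [e2] at hb
  rw [e1]
  have hp : 0 < x + 2 := by linarith
  calc (1 : ℝ) ≤ (4 * x / (x + 2)) * ((x + 4) / (x + 2)) * (x ^ 2 / (2 * x - 1) ^ 2) := by
        rw [div_mul_div_comm, div_mul_div_comm, le_div_iff₀ (by positivity)]
        nlinarith [mul_nonneg (sq_nonneg x) (sub_nonneg.2 hx)]
    _ ≤ _ := by
        have : 0 ≤ 4 * x / (x + 2) := div_nonneg (by linarith) hp.le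
        gcongr
end

section
/- For every natural number n ≥ 1, 2 · binom(2n+2, n) / binom(2n, n)^{1 + 2/n} ≥ 1/2, where binom denotes the usual binomial coefficient and the exponent 1 + 2/n is a real exponent. -/
lemma aux_central (n : ℕ) : (n.centralBinom : ℝ) ^ 2 * (2 * n + 1) ≤ 16 ^ n := by
  induction n with
  | zero => simp
  | succ k ih =>
    have h : ((k : ℝ) + 1) * ((k + 1).centralBinom : ℝ) = 2 * (2 * k + 1) * (k.centralBinom : ℝ) := by
      exact_mod_cast Nat.succ_mul_centralBinom_succ k
    have hk : (0 : ℝ) < (k : ℝ) + 1 := by positivity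
    have h2 : ((k + 1).centralBinom : ℝ) = 2 * (2 * k + 1) * (k.centralBinom : ℝ) / (k + 1) := by
      rw [eq_div_iff hk.ne']; linarith
    rw [h2, div_pow, div_mul_eq_mul_div, div_le_iff₀ (by positivity), pow_succ (16 : ℝ) k]
    push_cast
    have e1 : (2 * (2 * (k : ℝ) + 1) * k.centralBinom) ^ 2 * (2 * ((k : ℝ) + 1) + 1)
        = ((k.centralBinom : ℝ) ^ 2 * (2 * k + 1)) * (4 * ((2 * k + 1) * (2 * k + 3))) := by ring
    rw [e1]
    have e2 : (16 : ℝ) ^ k * 16 * ((k : ℝ) + 1) ^ 2 = 16 ^ k * (16 * ((k : ℝ) + 1) ^ 2) := by ring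
    rw [e2]
    apply mul_le_mul ih _ (by positivity) (by positivity)
    nlinarith

lemma aux_exp (n : ℕ) (hn : 2 ≤ n) :
    (2 * (n : ℝ) + 4) ^ n ≤ (2 * n + 1) * (2 * n + 1) ^ n := by
  have hn' : (2 : ℝ) ≤ n := by exact_mod_cast hn
  have hp : (0 : ℝ) < 2 * n + 1 := by positivity
  have h1 : (2 * (n : ℝ) + 4) = (3 / (2 * n + 1) + 1) * (2 * n + 1) := by field_simp; ring
  rw [h1, mul_pow]
  apply mul_le_mul_of_nonneg_right _ (by positivity)
  have h2 : (3 / (2 * (n : ℝ) + 1) + 1) ^ n ≤ Real.exp (3 / (2 * n + 1)) ^ n :=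
    pow_le_pow_left₀ (by positivity) (Real.add_one_le_exp _) n
  rw [← Real.exp_nat_mul] at h2
  have h3 : (n : ℝ) * (3 / (2 * n + 1)) ≤ 3 / 2 := by
    rw [mul_div_assoc', div_le_div_iff₀ hp (by norm_num)]; linarith
  have h4 : Real.exp (3 / 2) ≤ 5 := by
    have : Real.exp (3 / 2) ^ 2 ≤ 5 ^ 2 := by
      have e3 : Real.exp (3 / 2) ^ 2 = Real.exp 1 ^ 3 := by
        rw [← Real.exp_nat_mul, ← Real.exp_nat_mul]; norm_num
      rw [e3]
      have := Real.exp_one_lt_d9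
      calc Real.exp 1 ^ 3 ≤ 2.7182818286 ^ 3 := pow_le_pow_left₀ (Real.exp_pos _).le this.le 3
        _ ≤ 5 ^ 2 := by norm_num
    exact le_of_sq_le_sq this (by norm_num)
  have h5 := Real.exp_le_exp.mpr h3
  linarith

lemma aux_main_s16 (n : ℕ) (hn : 1 ≤ n) :
    (n.centralBinom : ℝ) ^ 2 ≤ (8 * (2 * n + 1) / (n + 2)) ^ n := by
  rcases hn.eq_or_lt with rfl | h
  · norm_num [Nat.centralBinom]
  · have h1 := aux_central n
    have h2 := aux_exp n h
    have e : (8 * (2 * (n : ℝ) + 1) / (n + 2)) = 16 * (2 * n + 1) / (2 * n + 4) := by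
      field_simp; ring
    rw [e, div_pow, mul_pow, le_div_iff₀ (by positivity)]
    calc (n.centralBinom : ℝ) ^ 2 * (2 * n + 4) ^ n
        ≤ (n.centralBinom : ℝ) ^ 2 * ((2 * n + 1) * (2 * n + 1) ^ n) := by gcongr
      _ = ((n.centralBinom : ℝ) ^ 2 * (2 * n + 1)) * (2 * n + 1) ^ n := by ring
      _ ≤ _ := by gcongr

lemma aux_choose (n : ℕ) : (Nat.choose (2 * n + 2) n : ℝ) * (n + 2)
    = Nat.choose (2 * n) n * (2 * (2 * n + 1)) := by
  have h1 : ((n : ℝ) + 1) * ((n + 1).centralBinom : ℝ) = 2 * (2 * n + 1) * (n.centralBinom : ℝ) := by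
    exact_mod_cast Nat.succ_mul_centralBinom_succ n
  have h2 := Nat.choose_succ_right_eq (2 * n + 2) n
  have h3 : 2 * n + 2 - n = n + 2 := by omega
  rw [h3] at h2
  have h4 : (Nat.choose (2 * n + 2) (n + 1) : ℝ) * (n + 1) = Nat.choose (2 * n + 2) n * (n + 2) := by
    exact_mod_cast h2
  rw [Nat.centralBinom, Nat.centralBinom, show 2 * (n + 1) = 2 * n + 2 by ring] at h1
  linarith

/-- (Lemma `lem:Induction`.) For every `n ≥ 1`,
`2 · binom(2n+2, n) / binom(2n, n)^(1 + 2/n) ≥ 1/2`. -/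
theorem statement16 (n : ℕ) (hn : 1 ≤ n) :
    (1 : ℝ) / 2 ≤
      2 * (Nat.choose (2 * n + 2) n : ℝ) /
        (Nat.choose (2 * n) n : ℝ) ^ ((1 : ℝ) + 2 / (n : ℝ)) := by
  have hm := aux_main_s16 n hn
  have hc := aux_choose n
  rw [Nat.centralBinom] at hm
  have hC : (0 : ℝ) < Nat.choose (2 * n) n := by
    exact_mod_cast Nat.choose_pos (by omega)
  set C : ℝ := (Nat.choose (2 * n) n : ℝ) with hCdef
  have hn0 : n ≠ 0 := by omega
  have hp : C ^ (2 / (n : ℝ)) ≤ 8 * (2 * n + 1) / (n + 2) := by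
    have := Real.rpow_le_rpow (by positivity) hm (show (0 : ℝ) ≤ (n : ℝ)⁻¹ by positivity)
    rw [Real.pow_rpow_inv_natCast (by positivity) hn0, ← Real.rpow_natCast C 2,
      ← Real.rpow_mul hC.le] at this
    simpa [div_eq_mul_inv] using this
  rw [Real.rpow_add hC, Real.rpow_one, le_div_iff₀ (by positivity)]
  have e : (Nat.choose (2 * n + 2) n : ℝ) = C * (2 * (2 * n + 1)) / (n + 2) := by
    rw [eq_div_iff (by positivity)]; exact hc
  rw [e]
  calc 1 / 2 * (C * C ^ (2 / (n : ℝ))) ≤ 1 / 2 * (C * (8 * (2 * n + 1) / (n + 2))) := by gcongr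
    _ = _ := by ring
end

section
/- For every natural number n ≥ 1, (16n/(n+2))^n ≥ (n+1)² · C_n², where C_n := (1/(n+1)) · binom(2n, n) is the n-th Catalan number and binom denotes the usual binomial coefficient. -/
theorem cb_bound (n : ℕ) :
    (n.centralBinom : ℝ) ^ 2 * (3 * n + 1) ≤ 16 ^ n := by
  induction n with
  | zero => simp
  | succ k ih =>
    have h : ((k : ℝ) + 1) * (k + 1).centralBinom = 2 * (2 * k + 1) * k.centralBinom :=
      mod_cast Nat.succ_mul_centralBinom_succ k
    have hk : (0 : ℝ) ≤ k := k.cast_nonneg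
    set a : ℝ := ((k + 1).centralBinom : ℝ)
    set b : ℝ := (k.centralBinom : ℝ)
    have hp : (0 : ℝ) < ((k : ℝ) + 1) ^ 2 := by positivity
    push_cast
    refine le_of_mul_le_mul_left ?_ hp
    calc ((k : ℝ) + 1) ^ 2 * (a ^ 2 * (3 * (k + 1) + 1))
        = (((k : ℝ) + 1) * a) ^ 2 * (3 * k + 4) := by ring
      _ = b ^ 2 * (4 * ((2 * k + 1) ^ 2 * (3 * k + 4))) := by rw [h]; ring
      _ ≤ b ^ 2 * (4 * (4 * (k + 1) ^ 2 * (3 * k + 1))) := by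
          gcongr b ^ 2 * (4 * ?_)
          nlinarith
      _ = (16 * (k + 1) ^ 2) * (b ^ 2 * (3 * k + 1)) := by ring
      _ ≤ (16 * (k + 1) ^ 2) * 16 ^ k := by gcongr
      _ = _ := by ring

/-- For every `n ≥ 1`, `(16n/(n+2))^n ≥ (n+1)² · C_n²`, where
`C_n = (1/(n+1)) · binom(2n,n)` is the `n`-th Catalan number. -/
theorem statement17 (n : ℕ) (hn : 1 ≤ n) :
    ((n : ℝ) + 1) ^ 2 * ((1 / ((n : ℝ) + 1)) * (Nat.choose (2 * n) n : ℝ)) ^ 2 ≤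
      (16 * (n : ℝ) / ((n : ℝ) + 2)) ^ n := by
  have h0 : (0 : ℝ) < n := by exact_mod_cast hn
  have e : ((n : ℝ) + 1) ^ 2 * ((1 / ((n : ℝ) + 1)) * (Nat.choose (2 * n) n : ℝ)) ^ 2
      = (n.centralBinom : ℝ) ^ 2 := by
    rw [Nat.centralBinom_eq_two_mul_choose]
    field_simp
  rw [e]
  rcases Nat.lt_or_ge n 3 with h | h
  · interval_cases n
    · norm_num [Nat.centralBinom, Nat.choose]
    · norm_num [Nat.centralBinom, Nat.choose]
  have hb := cb_bound n
  have h3 : (3 : ℝ) ≤ n := by exact_mod_cast h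
  have h1 : (1 + 2 / (n : ℝ)) ^ n ≤ 3 * n + 1 := by
    calc (1 + 2 / (n : ℝ)) ^ n ≤ (Real.exp (2 / n)) ^ n := by
          gcongr
          linarith [Real.add_one_le_exp (2 / (n : ℝ))]
      _ = Real.exp 1 ^ 2 := by
          rw [← Real.exp_nat_mul, ← Real.exp_nat_mul]
          congr 1
          push_cast
          field_simp
      _ ≤ 3 * n + 1 := by
          nlinarith [Real.exp_one_lt_d9, Real.exp_pos 1]
  have e2 : 16 * (n : ℝ) / ((n : ℝ) + 2) = 16 / (1 + 2 / (n : ℝ)) := by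
    field_simp
  rw [e2, div_pow, le_div_iff₀ (by positivity)]
  exact (mul_le_mul_of_nonneg_left h1 (sq_nonneg _)).trans hb
end
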